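/- arXiv:1010.5311 — 4 statements merged into one kernel-verified Lean document; each statement's English description precedes it below -/
import Mathlib

section
/- Let k ≥ 2, set m = ⌈log₂(k+2)⌉, and suppose 2^m − C(m,⌊m/2⌋) ≤ k ≤ 2^m − 2. Then for every n ≥ 1, every D_k-free family F of subsets of [n] satisfies |F| ≤ (m + 1 − (2^m − k − 1)/C(m,⌊m/2⌋)) · C(n,⌊n/2⌋). -/
open Finset

/-- `F` is `D_k`-free: there are no pairwise distinct `A, B_1, …, B_k, C ∈ F`
with `A ⊆ B_i ⊆ C` for all `i`. -/
def DkFree (n k : ℕ) (F : Finset (Finset (Fin n))) : Prop :=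
  ¬ ∃ (A C : Finset (Fin n)) (B : Fin k → Finset (Fin n)),
      A ∈ F ∧ C ∈ F ∧ (∀ i, B i ∈ F) ∧
      Function.Injective B ∧ (∀ i, B i ≠ A ∧ B i ≠ C) ∧ A ≠ C ∧
      (∀ i, A ⊆ B i ∧ B i ⊆ C)

namespace DkAux

/-- truncated level weight sum -/
def gsum (M d : ℕ) : ℕ := ∑ i ∈ range (d + 1), (M - d.choose i)

lemma gsum_succ (M d : ℕ) (h : M ≤ (d + 1).choose ((d + 1) / 2)) :
    gsum M (d + 1) ≤ gsum M d := by
  unfold gsum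
  obtain ⟨c, hc⟩ : ∃ c, c = (d + 1) / 2 := ⟨_, rfl⟩
  obtain ⟨e, he⟩ : ∃ e, d = c + e := ⟨d - c, by omega⟩
  rw [← hc] at h
  have e1 : d + 1 + 1 = c + (e + 1 + 1) := by omega
  have e2 : d + 1 = c + (e + 1) := by omega
  rw [e1, Finset.sum_range_add, Finset.sum_range_succ' _ (e + 1)]
  have e3 : ∑ i ∈ range (d + 1), (M - d.choose i) = ∑ i ∈ range c, (M - d.choose i) +
      ∑ i ∈ range (e + 1), (M - d.choose (c + i)) := by rw [e2, Finset.sum_range_add]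
  rw [e3]
  have hz : M - (d + 1).choose (c + 0) = 0 := Nat.sub_eq_zero_of_le h
  rw [hz, add_zero (∑ x ∈ range (e + 1), _)]
  refine Nat.add_le_add (Finset.sum_le_sum fun i _ => ?_) (Finset.sum_le_sum fun i _ => ?_)
  · exact Nat.sub_le_sub_left (Nat.choose_le_succ d i) M
  · refine Nat.sub_le_sub_left ?_ M
    rw [← Nat.add_assoc, Nat.choose_succ_succ]
    omega

lemma gsum_le (m d : ℕ) (h : m ≤ d) :
    gsum (m.choose (m / 2)) d ≤ gsum (m.choose (m / 2)) m := by
  induction d, h using Nat.le_induction with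
  | base => exact le_rfl
  | succ d hd ih =>
    refine (gsum_succ _ _ ?_).trans ih
    exact (Nat.choose_le_choose _ (by omega)).trans (Nat.choose_le_middle _ _)

lemma gsum_self (m : ℕ) :
    gsum (m.choose (m / 2)) m + 2 ^ m = (m + 1) * m.choose (m / 2) := by
  unfold gsum
  rw [← Nat.sum_range_choose, ← Finset.sum_add_distrib]
  rw [Finset.sum_congr rfl (g := fun _ => m.choose (m / 2))]
  · simp
  · intro i _
    have := Nat.choose_le_middle i m
    omega

variable {n : ℕ}

open Numbering

/-- `f` has least member `A` and greatest member `B` of `F` among its prefixes -/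
def Block (F : Finset (Finset (Fin n))) (A B : Finset (Fin n)) (f : Numbering (Fin n)) : Prop :=
  A ∈ F ∧ B ∈ F ∧ IsPrefix f A ∧ IsPrefix f B ∧ ∀ S ∈ F, IsPrefix f S → A ⊆ S ∧ S ⊆ B

lemma prefix_total {f : Numbering (Fin n)} {S T : Finset (Fin n)} (hS : IsPrefix f S)
    (hT : IsPrefix f T) : S ⊆ T ∨ T ⊆ S := by
  rcases le_total #S #T with h | h
  · exact Or.inl (hS.subset_of_card_le_card hT h)
  · exact Or.inr (hT.subset_of_card_le_card hS h)

lemma prefix_eq {f : Numbering (Fin n)} {S T : Finset (Fin n)} (hS : IsPrefix f S)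
    (hT : IsPrefix f T) (h : #S = #T) : S = T :=
  Finset.Subset.antisymm (hS.subset_of_card_le_card hT h.le) (hT.subset_of_card_le_card hS h.ge)

lemma prefix_perm (f : Numbering (Fin n)) (π : Equiv.Perm (Fin n)) {S T : Finset (Fin n)}
    (hST : ∀ x, π x ∈ T ↔ x ∈ S) (hS : IsPrefix f S) : IsPrefix (π.symm.trans f) T := by
  have hc : #T = #S := by
    have : T = S.map π.toEmbedding := by
      ext y
      obtain ⟨x, rfl⟩ := π.surjective y
      simp [hST]
    rw [this, card_map]
  intro y
  obtain ⟨x, rfl⟩ := π.surjective y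
  rw [hST, hc]
  simpa using hS x

lemma block_swap {F : Finset (Finset (Fin n))} {A B : Finset (Fin n)} {f : Numbering (Fin n)}
    (hf : Block F A B f) (hAB : A ⊆ B) {x y : Fin n} (hxA : x ∉ A) (hyA : y ∉ A) (hxB : x ∈ B)
    (hyB : y ∈ B) : Block F A B ((Equiv.swap x y).symm.trans f) := by
  obtain ⟨hA, hB, pA, pB, h⟩ := hf
  -- sets on which the swap acts trivially
  have key : ∀ S : Finset (Fin n), (x ∈ S ↔ y ∈ S) → ∀ z, Equiv.swap x y z ∈ S ↔ z ∈ S := by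
    intro S hS z
    by_cases hzx : z = x
    · subst hzx; simp [hS]
    by_cases hzy : z = y
    · subst hzy; simp [hS]
    rw [Equiv.swap_apply_of_ne_of_ne hzx hzy]
  have pA' : IsPrefix ((Equiv.swap x y).symm.trans f) A :=
    prefix_perm f _ (key A (by simp [hxA, hyA])) pA
  have pB' : IsPrefix ((Equiv.swap x y).symm.trans f) B :=
    prefix_perm f _ (key B (by simp [hxB, hyB])) pB
  have back : ∀ S : Finset (Fin n), (x ∈ S ↔ y ∈ S) →
      IsPrefix ((Equiv.swap x y).symm.trans f) S → IsPrefix f S := by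
    intro S hS hp
    have := prefix_perm _ (Equiv.swap x y) (key S hS) hp
    convert this using 1
    ext z
    simp
  refine ⟨hA, hB, pA', pB', fun S hS pS => ⟨?_, ?_⟩⟩
  · rcases prefix_total pA' pS with h1 | h1
    · exact h1
    · exact (h S hS (back S (by
        constructor
        · intro hh; exact absurd (h1 hh) hxA
        · intro hh; exact absurd (h1 hh) hyA) pS)).1
  · rcases prefix_total pB' pS with h1 | h1
    · exact (h S hS (back S (by simp [h1 hxB, h1 hyB]) pS)).2
    · exact h1

open Classical in
/-- the numberings of a block -/
noncomputable def blk (F : Finset (Finset (Fin n))) (A B : Finset (Fin n)) :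
    Finset (Numbering (Fin n)) := univ.filter (Block F A B)

/-- number of members of a block having `S` as prefix -/
noncomputable def cnt (F : Finset (Finset (Fin n))) (A B S : Finset (Fin n)) : ℕ :=
  #((blk F A B).filter fun f => IsPrefix f S)

lemma cnt_swap_le (F : Finset (Finset (Fin n))) {A B S T : Finset (Fin n)} (hAB : A ⊆ B)
    {x y : Fin n} (hxA : x ∉ A) (hyA : y ∉ A) (hxB : x ∈ B)
    (hyB : y ∈ B) (hST : ∀ z, Equiv.swap x y z ∈ T ↔ z ∈ S) :
    cnt F A B S ≤ cnt F A B T := by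
  unfold cnt
  refine Finset.card_le_card_of_injOn (fun f => (Equiv.swap x y).symm.trans f) ?_ ?_
  · intro f hf
    simp only [blk, coe_filter, mem_filter, mem_univ, true_and, Set.mem_ofPred_eq] at hf ⊢
    exact ⟨block_swap hf.1 hAB hxA hyA hxB hyB, prefix_perm f _ hST hf.2⟩
  · intro f _ g _ hfg
    ext z
    have := congrArg (fun e : Numbering (Fin n) => e (Equiv.swap x y z)) hfg
    simpa using congrArg Fin.val this

lemma cnt_le (F : Finset (Finset (Fin n))) {A B : Finset (Fin n)} (hAB : A ⊆ B) (r : ℕ) :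
    ∀ S T : Finset (Fin n), #(S \ T) = r → #S = #T → A ⊆ S → S ⊆ B → A ⊆ T → T ⊆ B →
    cnt F A B S ≤ cnt F A B T := by
  induction r with
  | zero =>
    intro S T h0 hc _ _ _ _
    have : S ⊆ T := by simpa [Finset.sdiff_eq_empty_iff_subset] using h0
    rw [Finset.eq_of_subset_of_card_le this hc.ge]
  | succ r ih =>
    intro S T h0 hc hAS hSB hAT hTB
    obtain ⟨x, hx⟩ : (S \ T).Nonempty := by rw [← card_pos]; omega
    have h1 : #(T \ S) = r + 1 := by
      have a1 := card_sdiff_add_card_inter S T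
      have a2 := card_sdiff_add_card_inter T S
      rw [inter_comm] at a2
      omega
    obtain ⟨y, hy⟩ : (T \ S).Nonempty := by rw [← card_pos]; omega
    rw [mem_sdiff] at hx hy
    have hxy : x ≠ y := by rintro rfl; exact hx.2 hy.1
    have hxA : x ∉ A := fun h => hx.2 (hAT h)
    have hyA : y ∉ A := fun h => hy.2 (hAS h)
    have hyS : y ∉ S.erase x := fun h => hy.2 (mem_of_mem_erase h)
    refine (cnt_swap_le F (T := insert y (S.erase x)) hAB hxA hyA (hSB hx.1) (hTB hy.1) ?_).trans
      (ih _ T ?_ ?_ ?_ ?_ hAT hTB)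
    · intro z
      by_cases hzx : z = x
      · subst hzx; simp [hx.1]
      by_cases hzy : z = y
      · subst hzy; simp [hy.2, hxy]
      rw [Equiv.swap_apply_of_ne_of_ne hzx hzy]
      simp [hzx, hzy]
    · have : insert y (S.erase x) \ T = (S \ T).erase x := by
        ext z
        simp only [mem_sdiff, mem_insert, mem_erase]
        constructor
        · rintro ⟨rfl | h, h2⟩
          · exact absurd hy.1 h2
          · exact ⟨h.1, h.2, h2⟩
        · rintro ⟨h, h2, h3⟩
          exact ⟨Or.inr ⟨h, h2⟩, h3⟩
      rw [this, card_erase_of_mem (mem_sdiff.2 hx)]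
      omega
    · rw [card_insert_of_notMem hyS, card_erase_of_mem hx.1]
      have : 0 < #S := card_pos.2 ⟨x, hx.1⟩
      omega
    · intro z hz
      refine mem_insert_of_mem (mem_erase.2 ⟨?_, hAS hz⟩)
      rintro rfl; exact hxA hz
    · intro z hz
      rcases mem_insert.1 hz with rfl | h
      · exact hTB hy.1
      · exact hSB (mem_of_mem_erase h)

lemma cnt_mul_choose (F : Finset (Finset (Fin n))) {A B S : Finset (Fin n)} (hAS : A ⊆ S)
    (hSB : S ⊆ B) :
    cnt F A B S * (#B - #A).choose (#S - #A) ≤ #(blk F A B) := by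
  have hAB := hAS.trans hSB
  have hcB : #(B \ A) = #B - #A := card_sdiff_of_subset hAB
  have hle := card_le_card hAS
  let P := (powersetCard (#S - #A) (B \ A)).image (fun U => A ∪ U)
  have hP : ∀ T ∈ P, A ⊆ T ∧ T ⊆ B ∧ #T = #S := by
    intro T hT
    obtain ⟨U, hU, rfl⟩ := mem_image.1 hT
    rw [mem_powersetCard] at hU
    refine ⟨subset_union_left, union_subset hAB (hU.1.trans sdiff_subset), ?_⟩
    rw [card_union_of_disjoint, hU.2]
    · omega
    · exact disjoint_of_subset_right hU.1 disjoint_sdiff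
  have hPc : #P = (#B - #A).choose (#S - #A) := by
    rw [card_image_of_injOn, card_powersetCard, hcB]
    intro U hU V hV h
    simp only [mem_coe, mem_powersetCard] at hU hV
    have dU : Disjoint A U := disjoint_of_subset_right hU.1 disjoint_sdiff
    have dV : Disjoint A V := disjoint_of_subset_right hV.1 disjoint_sdiff
    have h' : A ∪ U = A ∪ V := h
    rw [← union_sdiff_cancel_left dU, h', union_sdiff_cancel_left dV]
  rw [← hPc, mul_comm, ← smul_eq_mul]
  calc #P • cnt F A B S ≤ ∑ T ∈ P, cnt F A B T := by
        refine Finset.card_nsmul_le_sum _ _ _ fun T hT => ?_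
        obtain ⟨h1, h2, h3⟩ := hP T hT
        exact cnt_le F hAB _ S T rfl h3.symm hAS hSB h1 h2
    _ = #(P.biUnion fun T => (blk F A B).filter fun f => IsPrefix f T) := by
        rw [card_biUnion]
        · rfl
        · intro T hT U hU hTU
          change Disjoint _ _
          rw [Finset.disjoint_left]
          intro f hf hg
          simp only [mem_filter] at hf hg
          exact hTU (prefix_eq hf.2 hg.2 ((hP T hT).2.2.trans (hP U hU).2.2.symm))
    _ ≤ #(blk F A B) := by
        refine card_le_card ?_
        intro f hf
        obtain ⟨T, _, hT⟩ := mem_biUnion.1 hf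
        exact (mem_filter.1 hT).1

/-- a function summed over the prefixes of a numbering in an interval -/
lemma chain_sum_le (f : Numbering (Fin n)) {A B : Finset (Fin n)}
    (w : ℕ → ℕ) (Q : Finset (Finset (Fin n))) (hQ : ∀ S ∈ Q, A ⊆ S ∧ S ⊆ B ∧ IsPrefix f S) :
    ∑ S ∈ Q, w (#S - #A) ≤ ∑ i ∈ range (#B - #A + 1), w i := by
  have inj : Set.InjOn (fun S : Finset (Fin n) => #S - #A) Q := by
    intro S hS T hT h
    have h1 := card_le_card (hQ S hS).1
    have h2 := card_le_card (hQ T hT).1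
    refine prefix_eq (hQ S hS).2.2 (hQ T hT).2.2 ?_
    have h' : #S - #A = #T - #A := h
    omega
  rw [← Finset.sum_image (f := w) (g := fun S : Finset (Fin n) => #S - #A) inj]
  refine Finset.sum_le_sum_of_subset ?_
  intro i hi
  obtain ⟨S, hS, rfl⟩ := mem_image.1 hi
  have h1 := card_le_card (hQ S hS).2.1
  simp only [mem_range]
  omega

lemma card_interval {k : ℕ} {F : Finset (Finset (Fin n))} (hF : DkFree n k F)
    {A B : Finset (Fin n)} (hA : A ∈ F) (hB : B ∈ F) (hne : A ≠ B) :
    #(F.filter fun S => A ⊆ S ∧ S ⊆ B) ≤ k + 1 := by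
  by_contra hcon
  push Not at hcon
  apply hF
  let Q := ((F.filter fun S => A ⊆ S ∧ S ⊆ B).erase A).erase B
  have hQ : k ≤ #Q := by
    have h1 := pred_card_le_card_erase (s := F.filter fun S => A ⊆ S ∧ S ⊆ B) (a := A)
    have h2 := pred_card_le_card_erase (s := (F.filter fun S => A ⊆ S ∧ S ⊆ B).erase A) (a := B)
    change k ≤ #(((F.filter fun S => A ⊆ S ∧ S ⊆ B).erase A).erase B)
    omega
  obtain ⟨R, hRQ, hR⟩ := exists_subset_card_eq hQ
  let e := R.equivFinOfCardEq hR
  have hm : ∀ i, ((e.symm i : R) : Finset (Fin n)) ∈ Q := fun i => hRQ (e.symm i).2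
  simp only [Q, mem_erase, mem_filter] at hm
  refine ⟨A, B, fun i => (e.symm i : R), hA, hB, fun i => (hm i).2.2.1, ?_,
    fun i => ⟨(hm i).2.1, (hm i).1⟩, hne, fun i => (hm i).2.2.2⟩
  exact Subtype.val_injective.comp e.symm.injective

lemma block_bound {k m N : ℕ} {F : Finset (Finset (Fin n))} (hF : DkFree n k F)
    (hm : 2 ≤ m) (hN : N + 2 ^ m = (m + 1) * m.choose (m / 2) + (k + 1))
    (hk1 : 2 ^ m ≤ m.choose (m / 2) + k) (A B : Finset (Fin n)) :
    m.choose (m / 2) * ∑ f ∈ blk F A B, #(F.filter fun S => IsPrefix f S) ≤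
      N * #(blk F A B) := by
  rcases (blk F A B).eq_empty_or_nonempty with h0 | ⟨f0, hf0⟩
  · simp [h0]
  have hb : ∀ f ∈ blk F A B, Block F A B f := fun f hf => by simpa [blk] using hf
  obtain ⟨hA, hB, pA, pB, hall⟩ := hb f0 hf0
  have hAB : A ⊆ B := (hall A hA pA).2
  set M := m.choose (m / 2) with hM
  have hg := gsum_self m
  rw [← hM] at hg
  rcases lt_or_ge (#B - #A) m with hd | hd
  · have hNm : M * m ≤ N := by nlinarith
    have : ∀ f ∈ blk F A B, #(F.filter fun S => IsPrefix f S) ≤ m := by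
      intro f hf
      have := chain_sum_le (A := A) (B := B) f (fun _ => 1) (F.filter fun S => IsPrefix f S) (by
        intro S hS
        rw [mem_filter] at hS
        have := (hb f hf).2.2.2.2 S hS.1 hS.2
        exact ⟨this.1, this.2, hS.2⟩)
      simp at this
      omega
    calc M * ∑ f ∈ blk F A B, #(F.filter fun S => IsPrefix f S)
        ≤ M * (#(blk F A B) * m) := by
          gcongr
          exact (sum_le_card_nsmul _ _ _ this).trans (by simp)
      _ = (M * m) * #(blk F A B) := by ring
      _ ≤ _ := by gcongr
  · have hne : A ≠ B := by
      rintro rfl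
      simp at hd
      omega
    have hI := card_interval hF hA hB hne
    set I := F.filter fun S => A ⊆ S ∧ S ⊆ B with hIdef
    have hgl := gsum_le m (#B - #A) hd
    rw [← hM] at hgl
    have e1 : ∑ f ∈ blk F A B, #(F.filter fun S => IsPrefix f S) = ∑ S ∈ I, cnt F A B S := by
      have : ∀ f ∈ blk F A B, #(F.filter fun S => IsPrefix f S) =
          #(I.filter fun S => IsPrefix f S) := by
        intro f hf
        congr 1
        ext S
        simp only [hIdef, mem_filter]
        constructor
        · rintro ⟨h1, h2⟩
          exact ⟨⟨h1, (hb f hf).2.2.2.2 S h1 h2⟩, h2⟩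
        · rintro ⟨⟨h1, _⟩, h2⟩
          exact ⟨h1, h2⟩
      rw [sum_congr rfl this]
      exact sum_card_bipartiteAbove_eq_sum_card_bipartiteBelow (fun f S => IsPrefix f S)
    have e2 : ∑ S ∈ I, cnt F A B S * (M - (#B - #A).choose (#S - #A)) ≤
        #(blk F A B) * gsum M (#B - #A) := by
      have : ∀ S ∈ I, cnt F A B S * (M - (#B - #A).choose (#S - #A)) =
          ∑ f ∈ blk F A B, if IsPrefix f S then (M - (#B - #A).choose (#S - #A)) else 0 := by
        intro S _
        rw [← sum_filter, sum_const, smul_eq_mul]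
        rfl
      rw [sum_congr rfl this, sum_comm, ← smul_eq_mul]
      refine sum_le_card_nsmul _ _ _ fun f hf => ?_
      rw [← sum_filter]
      refine chain_sum_le (A := A) (B := B) f (fun i => M - (#B - #A).choose i) _ ?_
      intro S hS
      simp only [hIdef, mem_filter] at hS
      exact ⟨hS.1.2.1, hS.1.2.2, hS.2⟩
    rw [e1, mul_sum]
    calc ∑ S ∈ I, M * cnt F A B S
        ≤ ∑ S ∈ I, (#(blk F A B) + cnt F A B S * (M - (#B - #A).choose (#S - #A))) := by
          refine sum_le_sum fun S hS => ?_
          simp only [hIdef, mem_filter] at hS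
          have h1 := cnt_mul_choose F hS.2.1 hS.2.2
          have h2 : M ≤ (#B - #A).choose (#S - #A) + (M - (#B - #A).choose (#S - #A)) := by omega
          have h3 := Nat.mul_le_mul_left (cnt F A B S) h2
          rw [mul_add] at h3
          rw [mul_comm M]
          omega
      _ = #I * #(blk F A B) + ∑ S ∈ I, cnt F A B S * (M - (#B - #A).choose (#S - #A)) := by
          rw [sum_add_distrib, sum_const, smul_eq_mul]
      _ ≤ (k + 1) * #(blk F A B) + #(blk F A B) * gsum M m := by
          refine Nat.add_le_add (Nat.mul_le_mul_right _ hI) (e2.trans ?_)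
          exact Nat.mul_le_mul_left _ hgl
      _ = (k + 1 + gsum M m) * #(blk F A B) := by ring
      _ ≤ N * #(blk F A B) := by
          refine Nat.mul_le_mul_right _ ?_
          omega

lemma exists_block {F : Finset (Finset (Fin n))} {f : Numbering (Fin n)}
    (h : (F.filter fun S => IsPrefix f S).Nonempty) : ∃ A B, Block F A B f := by
  obtain ⟨A, hA, hA'⟩ := exists_min_image _ (fun S : Finset (Fin n) => #S) h
  obtain ⟨B, hB, hB'⟩ := exists_max_image _ (fun S : Finset (Fin n) => #S) h
  rw [mem_filter] at hA hB
  refine ⟨A, B, hA.1, hB.1, hA.2, hB.2, fun S hS pS => ⟨?_, ?_⟩⟩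
  · exact hA.2.subset_of_card_le_card pS (hA' S (mem_filter.2 ⟨hS, pS⟩))
  · exact pS.subset_of_card_le_card hB.2 (hB' S (mem_filter.2 ⟨hS, pS⟩))

lemma block_unique {F : Finset (Finset (Fin n))} {f : Numbering (Fin n)} {A B A' B'}
    (h : Block F A B f) (h' : Block F A' B' f) : A = A' ∧ B = B' := by
  obtain ⟨a, b, pa, pb, h⟩ := h
  obtain ⟨a', b', pa', pb', h'⟩ := h'
  exact ⟨Subset.antisymm (h _ a' pa').1 (h' _ a pa).1,
    Subset.antisymm (h' _ b pb).2 (h _ b' pb').2⟩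

lemma total_bound {k m N : ℕ} {F : Finset (Finset (Fin n))} (hF : DkFree n k F)
    (hm : 2 ≤ m) (hN : N + 2 ^ m = (m + 1) * m.choose (m / 2) + (k + 1))
    (hk1 : 2 ^ m ≤ m.choose (m / 2) + k) :
    m.choose (m / 2) * ∑ f : Numbering (Fin n), #(F.filter fun S => IsPrefix f S) ≤
      N * n.factorial := by
  classical
  let U : Finset (Numbering (Fin n)) :=
    (univ : Finset (Finset (Fin n) × Finset (Fin n))).biUnion fun p => blk F p.1 p.2
  have hdis : ∀ p ∈ (univ : Finset (Finset (Fin n) × Finset (Fin n))),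
      ∀ q ∈ (univ : Finset (Finset (Fin n) × Finset (Fin n))), p ≠ q →
      Disjoint (blk F p.1 p.2) (blk F q.1 q.2) := by
    intro p _ q _ hpq
    rw [Finset.disjoint_left]
    intro f hf hg
    simp only [blk, mem_filter] at hf hg
    exact hpq (Prod.ext_iff.2 (block_unique hf.2 hg.2))
  have e1 : ∑ f : Numbering (Fin n), #(F.filter fun S => IsPrefix f S) =
      ∑ f ∈ U, #(F.filter fun S => IsPrefix f S) := by
    symm
    refine sum_subset (subset_univ _) fun f _ hf => ?_
    by_contra hne
    obtain ⟨A, B, hAB⟩ := exists_block (card_pos.1 (Nat.pos_of_ne_zero hne))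
    exact hf (mem_biUnion.2 ⟨(A, B), mem_univ _, by simpa [blk] using hAB⟩)
  have hU : #U ≤ n.factorial := by
    refine (card_le_univ U).trans ?_
    rw [Fintype.card_numbering, Fintype.card_fin]
  rw [e1, sum_biUnion hdis, mul_sum]
  calc _ ≤ ∑ p : Finset (Fin n) × Finset (Fin n), N * #(blk F p.1 p.2) :=
        sum_le_sum fun p _ => block_bound hF hm hN hk1 p.1 p.2
    _ = N * #U := by rw [← mul_sum, card_biUnion hdis]
    _ ≤ _ := Nat.mul_le_mul_left _ hU

lemma nat_bound {k m N : ℕ} {F : Finset (Finset (Fin n))} (hF : DkFree n k F)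
    (hm : 2 ≤ m) (hN : N + 2 ^ m = (m + 1) * m.choose (m / 2) + (k + 1))
    (hk1 : 2 ^ m ≤ m.choose (m / 2) + k) :
    m.choose (m / 2) * #F ≤ N * n.choose (n / 2) := by
  have h := total_bound hF hm hN hk1
  have e : ∑ f : Numbering (Fin n), #(F.filter fun S => IsPrefix f S) =
      ∑ S ∈ F, #(prefixed S) :=
    sum_card_bipartiteAbove_eq_sum_card_bipartiteBelow (fun f S => IsPrefix f S)
  have h2 : #F * n.factorial ≤ n.choose (n / 2) * ∑ S ∈ F, #(prefixed S) := by
    rw [mul_sum, ← smul_eq_mul]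
    refine card_nsmul_le_sum _ _ _ fun S _ => ?_
    have hS : #S ≤ n := by simpa using card_le_univ S
    rw [card_prefixed, Fintype.card_fin, ← Nat.choose_mul_factorial_mul_factorial hS, mul_assoc]
    exact Nat.mul_le_mul_right _ (Nat.choose_le_middle _ _)
  rw [e] at h
  refine Nat.le_of_mul_le_mul_right ?_ n.factorial_pos
  calc m.choose (m / 2) * #F * n.factorial = m.choose (m / 2) * (#F * n.factorial) := by ring
    _ ≤ m.choose (m / 2) * (n.choose (n / 2) * ∑ S ∈ F, #(prefixed S)) :=
        Nat.mul_le_mul_left _ h2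
    _ = n.choose (n / 2) * (m.choose (m / 2) * ∑ S ∈ F, #(prefixed S)) := by ring
    _ ≤ n.choose (n / 2) * (N * n.factorial) := Nat.mul_le_mul_left _ h
    _ = _ := by ring

end DkAux

/-- For `k ≥ 2`, `m = ⌈log₂(k+2)⌉`, and `2^m - C(m,⌊m/2⌋) ≤ k ≤ 2^m - 2`,
every `D_k`-free family of subsets of `[n]` has size at most
`(m + 1 - (2^m - k - 1)/C(m,⌊m/2⌋)) · C(n,⌊n/2⌋)`. -/
theorem card_le_of_dkFree_case2 (k : ℕ) (hk : 2 ≤ k) (m : ℕ)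
    (hm : m = Nat.clog 2 (k + 2))
    (hk1 : 2 ^ m - m.choose (m / 2) ≤ k) (hk2 : k ≤ 2 ^ m - 2)
    (n : ℕ) (hn : 1 ≤ n)
    (F : Finset (Finset (Fin n))) (hF : DkFree n k F) :
    (F.card : ℝ) ≤
      ((m : ℝ) + 1 - ((2 : ℝ) ^ m - k - 1) / (m.choose (m / 2))) *
        (n.choose (n / 2)) := by
  have hm2 : 2 ≤ m := by
    by_contra hcon
    have : m = 0 ∨ m = 1 := by omega
    rcases this with h | h <;> rw [h] at hk2 <;> norm_num at hk2 <;> omega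
  have hk1' : 2 ^ m ≤ m.choose (m / 2) + k := by omega
  have hMpos : 0 < m.choose (m / 2) := Nat.choose_pos (by omega)
  obtain ⟨N, hN⟩ : ∃ N, N + 2 ^ m = (m + 1) * m.choose (m / 2) + (k + 1) :=
    ⟨(m + 1) * m.choose (m / 2) + (k + 1) - 2 ^ m, Nat.sub_add_cancel (by nlinarith)⟩
  have h := DkAux.nat_bound hF hm2 hN hk1'
  have hR : ((m.choose (m / 2) : ℕ) : ℝ) * (#F : ℝ) ≤ (N : ℝ) * (n.choose (n / 2) : ℕ) := by
    exact_mod_cast h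
  have hNR : (N : ℝ) + 2 ^ m = ((m : ℝ) + 1) * (m.choose (m / 2) : ℕ) + (k + 1) := by
    exact_mod_cast hN
  have hMR : (0 : ℝ) < (m.choose (m / 2) : ℕ) := by exact_mod_cast hMpos
  have e : (m : ℝ) + 1 - ((2 : ℝ) ^ m - k - 1) / (m.choose (m / 2)) =
      (N : ℝ) / (m.choose (m / 2)) := by
    field_simp
    linarith
  rw [e, div_mul_eq_mul_div, le_div_iff₀ hMR]
  linarith
end

section
/- Let k ≥ 1 and let l_1 > l_2 > ⋯ > l_k ≥ 3 be integers. Then for every n ≥ 1, every H(l_1,…,l_k)-free family F of subsets of [n] has Lubell function h̄(F) ≤ l_1 − 1. -/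
open Finset

/-- The Lubell function of a family `F` of subsets of `[n]`. -/
noncomputable def lubell (n : ℕ) (F : Finset (Finset (Fin n))) : ℝ :=
  ∑ A ∈ F, (1 : ℝ) / (n.choose A.card)

/-- `F` contains the harp `H(l 0, …, l (k-1))` as a weak subposet: there are
`A, C ∈ F` and, for each `i`, a chain `S i 0 ⊆ S i 1 ⊆ ⋯ ⊆ S i (l i - 3)` of
`l i - 2` sets of `F`, with `A ⊆ S i 0` and `S i (l i - 3) ⊆ C`, such that `A`,
`C`, and all the `S i j` are pairwise distinct. -/
def ContainsHarp {k : ℕ} (n : ℕ) (l : Fin k → ℕ) (F : Finset (Finset (Fin n))) : Prop :=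
  ∃ (A C : Finset (Fin n)) (S : Fin k → ℕ → Finset (Fin n)),
    A ∈ F ∧ C ∈ F ∧ A ≠ C ∧
    (∀ i, ∀ j < l i - 2, S i j ∈ F) ∧
    (∀ i, ∀ j, j + 1 < l i - 2 → S i j ⊆ S i (j + 1)) ∧
    (∀ i, A ⊆ S i 0) ∧ (∀ i, S i (l i - 3) ⊆ C) ∧
    (∀ i, ∀ j < l i - 2, S i j ≠ A ∧ S i j ≠ C) ∧
    (∀ i, ∀ j < l i - 2, ∀ i', ∀ j' < l i' - 2,
      (i, j) ≠ (i', j') → S i j ≠ S i' j')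

/-- `F` is `H(l 0, …, l (k-1))`-free. -/
def HarpFree {k : ℕ} (n : ℕ) (l : Fin k → ℕ) (F : Finset (Finset (Fin n))) : Prop :=
  ¬ ContainsHarp n l F

/-- `S` is an initial segment of the ordering `σ`. -/
def Pre {n : ℕ} (σ : Fin n ≃ Fin n) (S : Finset (Fin n)) : Prop :=
  ∀ a ∈ S, ∀ b ∉ S, σ a < σ b

theorem Pre.total {n : ℕ} {σ : Fin n ≃ Fin n} {S T : Finset (Fin n)}
    (hS : Pre σ S) (hT : Pre σ T) : S ⊆ T ∨ T ⊆ S := by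
  by_contra! h
  obtain ⟨h1, h2⟩ := h
  rw [Finset.not_subset] at h1 h2
  obtain ⟨a, ha, ha'⟩ := h1
  obtain ⟨b, hb, hb'⟩ := h2
  exact lt_asymm (hS a ha b hb') (hT b hb a ha')

open Classical in
theorem card_pre {n : ℕ} (S : Finset (Fin n)) :
    S.card.factorial * (n - S.card).factorial ≤
      (Finset.univ.filter (fun σ : Fin n ≃ Fin n => Pre σ S)).card := by
  have h := Numbering.card_prefixed S
  rw [Fintype.card_fin] at h
  rw [← h]
  refine Finset.card_le_card_of_injOn
    (fun f => (f : Fin n ≃ Fin (Fintype.card (Fin n))).trans (finCongr (Fintype.card_fin n))) ?_ ?_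
  · intro f hf
    have hf' := (Numbering.mem_prefixed.1 (Finset.mem_coe.1 hf))
    simp only [Finset.coe_filter, Finset.mem_univ, true_and, Set.mem_setOf_eq]
    intro a ha b hb
    have h1 := (hf' a).1 ha
    have h2 := mt (hf' b).2 hb
    simp only [Equiv.trans_apply, finCongr_apply, Fin.lt_def, Fin.val_cast]
    omega
  · intro f _ g _ hfg
    apply Equiv.ext
    intro x
    have := congrArg (fun e : Fin n ≃ Fin n => (e x).val) hfg
    exact Fin.ext (by simpa using this)

theorem pre_swap_mem {n : ℕ} {σ : Fin n ≃ Fin n} {S : Finset (Fin n)} {x y : Fin n}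
    (h : x ∈ S ↔ y ∈ S) : Pre ((Equiv.swap x y).trans σ) S ↔ Pre σ S := by
  have key : ∀ a, Equiv.swap x y a ∈ S ↔ a ∈ S := by
    intro a
    rw [Equiv.swap_apply_def]
    split_ifs <;> simp_all
  constructor
  · intro H a ha b hb
    have := H (Equiv.swap x y a) ((key a).2 ha) (Equiv.swap x y b) (mt (key b).1 hb)
    simpa using this
  · intro H a ha b hb
    exact H _ ((key a).2 ha) _ (mt (key b).1 hb)

/-- orderings whose least member of `F` is `A` and greatest `B`. -/
def Blk {n : ℕ} (F : Finset (Finset (Fin n))) (A B : Finset (Fin n)) (σ : Fin n ≃ Fin n) : Prop :=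
  Pre σ A ∧ Pre σ B ∧ ∀ S ∈ F, Pre σ S → A ⊆ S ∧ S ⊆ B

theorem Blk.swap {n : ℕ} {F : Finset (Finset (Fin n))} {A B : Finset (Fin n)} {σ : Fin n ≃ Fin n}
    (h : Blk F A B σ) {x y : Fin n} (hxA : x ∉ A) (hyA : y ∉ A)
    (hxB : x ∈ B) (hyB : y ∈ B) : Blk F A B ((Equiv.swap x y).trans σ) := by
  obtain ⟨hA, hB, hF⟩ := h
  have hA' := (pre_swap_mem (σ := σ) (S := A) (x := x) (y := y) (by tauto)).2 hA
  have hB' := (pre_swap_mem (σ := σ) (S := B) (x := x) (y := y) (by tauto)).2 hB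
  refine ⟨hA', hB', fun S hS hp => ⟨?_, ?_⟩⟩
  · rcases hA'.total hp with h | h
    · exact h
    · exact (hF S hS ((pre_swap_mem ⟨fun q => absurd (h q) hxA, fun q => absurd (h q) hyA⟩).1 hp)).1
  · rcases hB'.total hp with h | h
    · exact (hF S hS ((pre_swap_mem ⟨fun _ => h hyB, fun _ => h hxB⟩).1 hp)).2
    · exact h

theorem swap_lt_x {n : ℕ} {σ : Fin n ≃ Fin n} {S : Finset (Fin n)} {x y z : Fin n}
    (h : Pre σ S) (hx : x ∈ S) (hy : y ∉ S) (hz : z ∈ S) (hzx : z ≠ x) :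
    ((Equiv.swap x y).trans σ) z < ((Equiv.swap x y).trans σ) x := by
  have : z ≠ y := fun e => hy (e ▸ hz)
  simpa [Equiv.swap_apply_of_ne_of_ne hzx this] using h z hz y hy

theorem swap_lt_y {n : ℕ} {σ : Fin n ≃ Fin n} {S : Finset (Fin n)} {x y z : Fin n}
    (h : Pre σ S) (hx : x ∈ S) (hy : y ∉ S) (hz : z ∉ S) (hzx : z ≠ y) :
    ((Equiv.swap x y).trans σ) y < ((Equiv.swap x y).trans σ) z := by
  have : z ≠ x := fun e => hz (e ▸ hx)
  simpa [Equiv.swap_apply_of_ne_of_ne this hzx] using h x hx z hz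

open Classical in
theorem blk_bound {n : ℕ} (F : Finset (Finset (Fin n))) (A B S : Finset (Fin n))
    (hAS : A ⊂ S) (hSB : S ⊂ B) :
    (B.card - A.card - 1) * ((univ.filter (Blk F A B)).filter (fun σ => Pre σ S)).card
      ≤ (univ.filter (Blk F A B)).card := by
  have h1 := card_lt_card hAS
  have h2 := card_lt_card hSB
  have h3 : B.card - A.card - 1 ≤ ((S \ A) ×ˢ (B \ S)).card := by
    rw [card_product, card_sdiff_of_subset hAS.1, card_sdiff_of_subset hSB.1]
    obtain ⟨u, hu⟩ := Nat.exists_eq_add_of_lt h1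
    obtain ⟨v, hv⟩ := Nat.exists_eq_add_of_lt h2
    have e1 : S.card - A.card = u + 1 := by omega
    have e2 : B.card - S.card = v + 1 := by omega
    have e3 : B.card - A.card - 1 = u + v + 1 := by omega
    rw [e1, e2, e3]; nlinarith [Nat.zero_le (u * v)]
  refine (Nat.mul_le_mul_right _ h3).trans ?_
  rw [← card_product]
  refine card_le_card_of_injOn (fun p => (Equiv.swap p.1.1 p.1.2).trans p.2) ?_ ?_
  · rintro ⟨⟨x, y⟩, σ⟩ hp
    simp only [coe_product, coe_filter, Set.mem_prod, mem_coe, mem_sdiff, Set.mem_setOf_eq,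
      mem_filter, mem_univ, true_and] at hp ⊢
    obtain ⟨⟨⟨hx, hxA⟩, hyB, hy⟩, hb, hS⟩ := hp
    exact hb.swap hxA (fun q => hy (hAS.1 q)) (hSB.1 hx) hyB
  · rintro ⟨⟨x, y⟩, σ⟩ hp ⟨⟨x', y'⟩, σ'⟩ hp' heq
    simp only [coe_product, coe_filter, Set.mem_prod, mem_coe, mem_sdiff, Set.mem_setOf_eq,
      mem_filter, mem_univ, true_and] at hp hp' heq
    obtain ⟨⟨⟨hx, hxA⟩, hyB, hy⟩, hb, hS⟩ := hp
    obtain ⟨⟨⟨hx', hxA'⟩, hyB', hy'⟩, hb', hS'⟩ := hp'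
    have ex : x = x' := by
      by_contra hne
      have a1 := swap_lt_x hS hx hy hx' (Ne.symm hne)
      have a2 := swap_lt_x hS' hx' hy' hx hne
      rw [heq] at a1
      exact lt_asymm a1 a2
    have ey : y = y' := by
      by_contra hne
      have a1 := swap_lt_y hS hx hy hy' (Ne.symm hne)
      have a2 := swap_lt_y hS' hx' hy' hy hne
      rw [heq] at a1
      exact lt_asymm a1 a2
    subst ex ey
    have : σ = σ' := by
      apply Equiv.ext
      intro a
      have := congrArg (fun e : Fin n ≃ Fin n => e (Equiv.swap x y a)) heq
      simpa using this
    rw [this]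

open Classical in
theorem chain_bound {n : ℕ} (F : Finset (Finset (Fin n))) (A B : Finset (Fin n))
    (T : Finset (Finset (Fin n))) (hT : ∀ S ∈ T, A ⊂ S ∧ S ⊂ B)
    (hc : IsChain (· ⊆ ·) (T : Set (Finset (Fin n)))) :
    ∑ σ ∈ univ.filter (Blk F A B), (T.filter (Pre σ)).card ≤ (univ.filter (Blk F A B)).card := by
  have hsum : ∑ σ ∈ univ.filter (Blk F A B), (T.filter (Pre σ)).card
      = ∑ S ∈ T, ((univ.filter (Blk F A B)).filter (fun σ => Pre σ S)).card :=
    sum_card_bipartiteAbove_eq_sum_card_bipartiteBelow (fun σ S => Pre σ S)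
  have hcard : T.card ≤ B.card - A.card - 1 := by
    rw [← Nat.card_Ioo]
    refine card_le_card_of_injOn card ?_ ?_
    · intro S hS
      have := hT S hS
      simpa using ⟨card_lt_card this.1, card_lt_card this.2⟩
    · intro S hS S' hS' e
      rcases hc.total hS hS' with h | h
      · exact eq_of_subset_of_card_le h e.ge
      · exact (eq_of_subset_of_card_le h e.le).symm
  rw [hsum]
  rcases Nat.eq_zero_or_pos (B.card - A.card - 1) with h0 | hpos
  · have : T = ∅ := card_eq_zero.1 (by omega)
    simp [this]
  · refine Nat.le_of_mul_le_mul_left ?_ hpos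
    rw [mul_sum]
    calc _ ≤ ∑ S ∈ T, (univ.filter (Blk F A B)).card :=
          sum_le_sum fun S hS => blk_bound F A B S (hT S hS).1 (hT S hS).2
      _ = T.card * (univ.filter (Blk F A B)).card := by simp
      _ ≤ _ := Nat.mul_le_mul_right _ hcard

open Classical in
theorem greedy {n : ℕ} (F : Finset (Finset (Fin n))) (A B : Finset (Fin n)) (k : ℕ) :
    ∀ (m : Fin (k + 1) → ℕ), StrictAnti m → ∀ (G : Finset (Finset (Fin n))),
    (∀ S ∈ G, A ⊂ S ∧ S ⊂ B) →
    (¬ ∃ T : Fin (k + 1) → Finset (Finset (Fin n)), (∀ i, T i ⊆ G) ∧ (∀ i, (T i).card = m i) ∧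
      (∀ i, IsChain (· ⊆ ·) (T i : Set (Finset (Fin n)))) ∧
      (∀ i j, i ≠ j → Disjoint (T i) (T j))) →
    ∑ σ ∈ univ.filter (Blk F A B), (G.filter (Pre σ)).card + (univ.filter (Blk F A B)).card
      ≤ m 0 * (univ.filter (Blk F A B)).card := by
  induction k with
  | zero =>
    intro m hm G hG hno
    have : ∀ σ, (G.filter (Pre σ)).card + 1 ≤ m 0 := by
      intro σ
      by_contra! hlt
      obtain ⟨T, hT, hTc⟩ := exists_subset_card_eq (Nat.le_of_lt_succ hlt)
      refine hno ⟨fun _ => T, fun _ => hT.trans (filter_subset _ _), ?_, ?_, ?_⟩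
      · intro i; rw [hTc, show i = 0 from Fin.ext (by have := i.isLt; simp only [Fin.val_zero]; omega)]
      · intro i S hS S' hS' _
        exact (mem_filter.1 (hT hS)).2.total (mem_filter.1 (hT hS')).2
      · intro i j hij; exact absurd (Fin.ext (by have := i.isLt; have := j.isLt; omega)) hij
    rw [card_eq_sum_ones, ← sum_add_distrib, mul_sum]
    exact sum_le_sum fun σ _ => by simpa using this σ
  | succ k ih =>
    intro m hm G hG hno
    by_cases hex : ∃ T ⊆ G, T.card = m 0 ∧ IsChain (· ⊆ ·) (T : Set (Finset (Fin n)))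
    · obtain ⟨T, hTG, hTc, hch⟩ := hex
      have h1 := ih (Fin.tail m) (fun i j hij => hm (Fin.succ_lt_succ_iff.2 hij)) (G \ T)
        (fun S hS => hG S (mem_sdiff.1 hS).1) (by
          rintro ⟨U, hU, hUc, hUch, hUd⟩
          refine hno ⟨Fin.cons T U, ?_, ?_, ?_, ?_⟩
          · intro i; refine Fin.cases ?_ (fun i => ?_) i
            · simpa using hTG
            · simpa using (hU i).trans sdiff_subset
          · intro i; refine Fin.cases ?_ (fun i => ?_) i
            · simpa using hTc
            · simpa [Fin.tail] using hUc i
          · intro i; refine Fin.cases ?_ (fun i => ?_) i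
            · simpa using hch
            · simpa using hUch i
          · have hd : ∀ i, Disjoint T (U i) := fun i =>
              disjoint_sdiff.mono_right (hU i)
            intro i j
            refine Fin.cases ?_ (fun i => ?_) i <;> refine Fin.cases ?_ (fun j => ?_) j
            · simp
            · intro _; simpa using hd j
            · intro _; simpa using (hd i).symm
            · intro hij; simpa using hUd i j (fun e => hij (by rw [e])))
      have h2 := chain_bound F A B T (fun S hS => hG S (hTG hS)) hch
      have h3 : Fin.tail m 0 + 1 ≤ m 0 := hm (Fin.succ_pos 0)
      have h4 : ∀ σ, (G.filter (Pre σ)).card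
          = ((G \ T).filter (Pre σ)).card + (T.filter (Pre σ)).card := by
        intro σ
        conv_lhs => rw [← sdiff_union_of_subset hTG, filter_union]
        exact card_union_of_disjoint (disjoint_filter_filter sdiff_disjoint)
      simp only [h4, sum_add_distrib]
      have h5 := Nat.mul_le_mul_right (univ.filter (Blk F A B)).card h3
      rw [add_mul] at h5
      omega
    · have : ∀ σ, (G.filter (Pre σ)).card + 1 ≤ m 0 := by
        intro σ
        by_contra! hlt
        obtain ⟨T, hT, hTc⟩ := exists_subset_card_eq (Nat.le_of_lt_succ hlt)
        refine hex ⟨T, hT.trans (filter_subset _ _), hTc, ?_⟩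
        intro S hS S' hS' _
        exact (mem_filter.1 (hT hS)).2.total (mem_filter.1 (hT hS')).2
      rw [card_eq_sum_ones, ← sum_add_distrib, mul_sum]
      exact sum_le_sum fun σ _ => by simpa using this σ

theorem enum_chain {n : ℕ} (m : ℕ) : ∀ T : Finset (Finset (Fin n)), T.card = m →
    IsChain (· ⊆ ·) (T : Set (Finset (Fin n))) →
    ∃ s : ℕ → Finset (Fin n), (∀ j < m, s j ∈ T) ∧ (∀ j, j + 1 < m → s j ⊆ s (j + 1)) ∧
      (∀ j < m, ∀ j' < m, s j = s j' → j = j') := by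
  classical
  induction m with
  | zero => intro T _ _; exact ⟨fun _ => ∅, by simp, by simp, by simp⟩
  | succ m ih =>
    intro T hT hc
    have hne : T.Nonempty := card_pos.1 (by omega)
    obtain ⟨M, hM, hmax⟩ := exists_max_image T card hne
    obtain ⟨s, h1, h2, h3⟩ := ih (T.erase M) (by rw [card_erase_of_mem hM]; omega)
      (hc.mono (by simpa using erase_subset M T))
    have hle : ∀ S ∈ T, S ⊆ M := by
      intro S hS
      rcases hc.total hS hM with h | h
      · exact h
      · exact (eq_of_subset_of_card_le h (hmax S hS)).ge
    refine ⟨fun j => if j < m then s j else M, ?_, ?_, ?_⟩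
    · intro j _
      dsimp only
      split_ifs with h
      · exact mem_of_mem_erase (h1 j h)
      · exact hM
    · intro j hj
      dsimp only
      rw [if_pos (by omega)]
      split_ifs with h
      · exact h2 j h
      · exact hle _ (mem_of_mem_erase (h1 j (by omega)))
    · intro j hj j' hj'
      dsimp only
      split_ifs with h h' h'
      · exact h3 j h j' h'
      · intro e; exact absurd e (mem_erase.1 (h1 j h)).1
      · intro e; exact absurd e.symm (mem_erase.1 (h1 j' h')).1
      · intro _; omega

open Classical in
theorem block_le (k : ℕ) (l : Fin (k + 1) → ℕ)
    (hdec : StrictAnti l) (hl : ∀ i, 3 ≤ l i) (n : ℕ)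
    (F : Finset (Finset (Fin n))) (hF : HarpFree n l F) (A B : Finset (Fin n))
    (hA : A ∈ F) (hB : B ∈ F) (hAB : A ⊂ B) :
    ∑ σ ∈ univ.filter (Blk F A B), (F.filter (Pre σ)).card
      ≤ (l 0 - 1) * (univ.filter (Blk F A B)).card := by
  have h := greedy F A B k (fun i => l i - 2)
    (fun i j hij => by have := hdec hij; have := hl i; have := hl j; dsimp only; omega)
    (F.filter (fun S => A ⊂ S ∧ S ⊂ B)) (fun S hS => (mem_filter.1 hS).2) (by
      rintro ⟨T, hTG, hTc, hch, hd⟩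
      choose s h1 h2 h3 using fun i => enum_chain (l i - 2) (T i) (hTc i) (hch i)
      have hm : ∀ i, ∀ j < l i - 2, s i j ∈ F ∧ A ⊂ s i j ∧ s i j ⊂ B := fun i j hj =>
        mem_filter.1 (hTG i (h1 i j hj))
      refine hF ⟨A, B, s, hA, hB, hAB.ne, fun i j hj => (hm i j hj).1, h2, ?_, ?_, ?_, ?_⟩
      · intro i; exact (hm i 0 (by have := hl i; omega)).2.1.1
      · intro i; exact (hm i (l i - 3) (by have := hl i; omega)).2.2.1
      · intro i j hj; exact ⟨(hm i j hj).2.1.ne', (hm i j hj).2.2.ne⟩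
      · intro i j hj i' j' hj' hne e
        by_cases hii : i = i'
        · subst hii
          exact hne (by rw [h3 i j hj j' hj' e])
        · exact disjoint_left.1 (hd i i' hii) (h1 i j hj) (e ▸ h1 i' j' hj'))
  have hs : ∀ σ ∈ univ.filter (Blk F A B), (F.filter (Pre σ)).card
      ≤ ((F.filter (fun S => A ⊂ S ∧ S ⊂ B)).filter (Pre σ)).card + 2 := by
    intro σ hσ
    have hb := (mem_filter.1 hσ).2
    have hsub : F.filter (Pre σ) ⊆
        ((F.filter (fun S => A ⊂ S ∧ S ⊂ B)).filter (Pre σ)) ∪ {A, B} := by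
      intro S hS
      obtain ⟨hSF, hp⟩ := mem_filter.1 hS
      obtain ⟨q1, q2⟩ := hb.2.2 S hSF hp
      by_cases e1 : S = A
      · simp [e1]
      by_cases e2 : S = B
      · simp [e2]
      refine mem_union_left _ (mem_filter.2 ⟨mem_filter.2 ⟨hSF, ?_, ?_⟩, hp⟩)
      · exact lt_of_le_of_ne q1 (Ne.symm e1)
      · exact lt_of_le_of_ne q2 e2
    exact (card_le_card hsub).trans ((card_union_le _ _).trans
      (Nat.add_le_add_left card_le_two _))
  have h0 := hl 0
  have := sum_le_sum hs
  rw [sum_add_distrib, sum_const, smul_eq_mul] at this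
  obtain ⟨q, hq⟩ := Nat.exists_eq_add_of_le h0
  have e1 : l 0 - 2 = q + 1 := by omega
  have e2 : l 0 - 1 = q + 2 := by omega
  simp only [e1] at h
  rw [e2]
  nlinarith

/-- Every ordering is in a block. -/
theorem exists_blk {n : ℕ} (F : Finset (Finset (Fin n))) (σ : Fin n ≃ Fin n)
    (h : ∃ S ∈ F, Pre σ S) : ∃ A ∈ F, ∃ B ∈ F, A ⊆ B ∧ Blk F A B σ := by
  classical
  obtain ⟨S, hS, hp⟩ := h
  have hne : (F.filter (Pre σ)).Nonempty := ⟨S, mem_filter.2 ⟨hS, hp⟩⟩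
  obtain ⟨A, hA, hmin⟩ := exists_min_image _ card hne
  obtain ⟨B, hB, hmax⟩ := exists_max_image _ card hne
  obtain ⟨hAF, hAp⟩ := mem_filter.1 hA
  obtain ⟨hBF, hBp⟩ := mem_filter.1 hB
  have key : ∀ S ∈ F, Pre σ S → A ⊆ S ∧ S ⊆ B := by
    intro S hS hp
    have hm := mem_filter.2 ⟨hS, hp⟩
    constructor
    · rcases hAp.total hp with h | h
      · exact h
      · exact (eq_of_subset_of_card_le h (hmin S hm)).ge
    · rcases hBp.total hp with h | h
      · exact (eq_of_subset_of_card_le h (hmax S hm)).ge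
      · exact h
  exact ⟨A, hAF, B, hBF, (key B hBF hBp).1, hAp, hBp, key⟩

open Classical in
theorem total_le (k : ℕ) (l : Fin (k + 1) → ℕ)
    (hdec : StrictAnti l) (hl : ∀ i, 3 ≤ l i) (n : ℕ)
    (F : Finset (Finset (Fin n))) (hF : HarpFree n l F) :
    ∑ σ : Fin n ≃ Fin n, (F.filter (Pre σ)).card ≤ (l 0 - 1) * n.factorial := by
  have h0 := hl 0
  let P := (F ×ˢ F).filter (fun p => p.1 ⊆ p.2)
  have hdisj : Set.PairwiseDisjoint (P : Set (Finset (Fin n) × Finset (Fin n)))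
      (fun p => univ.filter (Blk F p.1 p.2)) := by
    rintro ⟨A, B⟩ hp ⟨A', B'⟩ hp' hne
    rw [Function.onFun, disjoint_left]
    intro σ hσ hσ'
    obtain ⟨a1, a2, a3⟩ := (mem_filter.1 hσ).2
    obtain ⟨b1, b2, b3⟩ := (mem_filter.1 hσ').2
    simp only [P, coe_filter, mem_product, Set.mem_setOf_eq] at hp hp'
    apply hne
    refine Prod.ext ?_ ?_
    · exact subset_antisymm (a3 A' hp'.1.1 b1).1 (b3 A hp.1.1 a1).1
    · exact subset_antisymm (b3 B hp.1.2 a2).2 (a3 B' hp'.1.2 b2).2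
  have hsub : ∑ σ : Fin n ≃ Fin n, (F.filter (Pre σ)).card
      = ∑ σ ∈ P.biUnion (fun p => univ.filter (Blk F p.1 p.2)), (F.filter (Pre σ)).card := by
    symm
    refine sum_subset (subset_univ _) fun σ _ hσ => ?_
    rw [card_eq_zero, filter_eq_empty_iff]
    intro S hS hp
    obtain ⟨A, hA, B, hB, hAB, hb⟩ := exists_blk F σ ⟨S, hS, hp⟩
    exact hσ (mem_biUnion.2 ⟨(A, B), mem_filter.2 ⟨mem_product.2 ⟨hA, hB⟩, hAB⟩,
      mem_filter.2 ⟨mem_univ _, hb⟩⟩)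
  rw [hsub, sum_biUnion hdisj]
  calc _ ≤ ∑ p ∈ P, (l 0 - 1) * (univ.filter (Blk F p.1 p.2)).card := by
        refine sum_le_sum ?_
        rintro ⟨A, B⟩ hp
        simp only [P, mem_filter, mem_product] at hp
        by_cases e : A = B
        · subst e
          rw [mul_comm, ← smul_eq_mul]
          refine sum_le_card_nsmul _ _ _ fun σ hσ => ?_
          have hb := (mem_filter.1 hσ).2
          refine le_trans (card_le_one.2 ?_) (by omega : 1 ≤ l 0 - 1)
          intro S hS S' hS'
          obtain ⟨s1, s2⟩ := mem_filter.1 hS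
          obtain ⟨t1, t2⟩ := mem_filter.1 hS'
          have := hb.2.2 S s1 s2
          have := hb.2.2 S' t1 t2
          exact subset_antisymm (by tauto_set) (by tauto_set)
        · exact block_le k l hdec hl n F hF A B hp.1.1 hp.1.2 (lt_of_le_of_ne hp.2 e)
    _ = (l 0 - 1) * (P.biUnion (fun p => univ.filter (Blk F p.1 p.2))).card := by
        rw [← mul_sum, card_biUnion hdisj]
    _ ≤ _ := by
        refine Nat.mul_le_mul_left _ ((card_le_univ _).trans ?_)
        have := Fintype.card_perm (α := Fin n)
        rw [Fintype.card_fin] at this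
        exact this.le

/-- For strictly decreasing path lengths `l 0 > l 1 > ⋯ > l (k-1) ≥ 3`, every
`H(l 0, …, l (k-1))`-free family of subsets of `[n]` has Lubell function at
most `l 0 - 1`. -/
theorem lubell_le_of_harpFree (k : ℕ) (hk : 1 ≤ k) (l : Fin k → ℕ)
    (hdec : StrictAnti l) (hl : ∀ i, 3 ≤ l i)
    (n : ℕ) (hn : 1 ≤ n)
    (F : Finset (Finset (Fin n))) (hF : HarpFree n l F) :
    lubell n F ≤ (l ⟨0, by omega⟩ : ℝ) - 1 := by
  classical
  obtain ⟨k, rfl⟩ := Nat.exists_eq_add_of_le' hk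
  have h := total_le k l hdec hl n F hF
  have hsum : ∑ σ : Fin n ≃ Fin n, (F.filter (Pre σ)).card
      = ∑ S ∈ F, (univ.filter (fun σ : Fin n ≃ Fin n => Pre σ S)).card :=
    sum_card_bipartiteAbove_eq_sum_card_bipartiteBelow (fun σ S => Pre σ S)
  rw [hsum] at h
  have h2 := (sum_le_sum fun S (_ : S ∈ F) => card_pre S).trans h
  have hpos : (0 : ℝ) < n.factorial := by exact_mod_cast n.factorial_pos
  have h3 : lubell n F * n.factorial
      = ((∑ S ∈ F, S.card.factorial * (n - S.card).factorial : ℕ) : ℝ) := by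
    rw [lubell, sum_mul, Nat.cast_sum]
    refine sum_congr rfl fun S _ => ?_
    have hle : S.card ≤ n := by simpa using card_le_univ S
    have hc := Nat.choose_mul_factorial_mul_factorial hle
    have hc0 : (n.choose S.card : ℝ) ≠ 0 := by
      exact_mod_cast (Nat.choose_pos hle).ne'
    rw [← hc]
    push_cast
    field_simp
  have h4 : lubell n F * n.factorial ≤ ((l 0 : ℝ) - 1) * n.factorial := by
    rw [h3]
    have h0 := hl 0
    have : ((l 0 : ℝ) - 1) = ((l 0 - 1 : ℕ) : ℝ) := by
      rw [Nat.cast_sub (by omega)]; simp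
    rw [this]
    exact_mod_cast h2
  exact le_of_mul_le_mul_right h4 hpos
end

section
/- Let k ≥ 1 and let l_1 > l_2 > ⋯ > l_k ≥ 3 be integers. Then for every n ≥ 1, if F is an H(l_1,…,l_k)-free family of subsets of [n] with |F| = Σ(n, l_1 − 1), then F equals B(n, l_1 − 1), i.e. F is either the family of all subsets A with ⌊(n−l_1+2)/2⌋ ≤ |A| ≤ ⌊(n+l_1−2)/2⌋ or the family of all subsets A with ⌈(n−l_1+2)/2⌉ ≤ |A| ≤ ⌈(n+l_1−2)/2⌉. -/
open Finset

/-- `Σ(n,m)`: the sum of the `m` largest binomial coefficients `C(n,i)`,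
i.e. `Σ_{i=0}^{m-1} C(n, ⌊(n-m+1)/2⌋ + i)`. -/
def middleBinomSum (n m : ℕ) : ℕ :=
  ∑ i ∈ Finset.range m, n.choose ((n - m + 1) / 2 + i)

/-- `B(n,m)` (lower variant): all subsets `A` of `[n]` with
`⌊(n-m+1)/2⌋ ≤ |A| ≤ ⌊(n+m-1)/2⌋`. -/
def Blow (n m : ℕ) : Finset (Finset (Fin n)) :=
  Finset.univ.filter (fun A => (n - m + 1) / 2 ≤ A.card ∧ A.card ≤ (n + m - 1) / 2)

/-- `B(n,m)` (upper variant): all subsets `A` of `[n]` with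
`⌈(n-m+1)/2⌉ ≤ |A| ≤ ⌈(n+m-1)/2⌉`. -/
def Bhigh (n m : ℕ) : Finset (Finset (Fin n)) :=
  Finset.univ.filter (fun A => (n - m + 2) / 2 ≤ A.card ∧ A.card ≤ (n + m) / 2)


def pre {n : ℕ} (σ : Equiv.Perm (Fin n)) (j : ℕ) : Finset (Fin n) :=
  univ.filter (fun z => (σ z : ℕ) < j)

/-- members of `F` on the full chain of `σ`. -/
def onc {n : ℕ} (F : Finset (Finset (Fin n))) (σ : Equiv.Perm (Fin n)) :
    Finset (Finset (Fin n)) :=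
  F.filter (fun X => pre σ X.card = X)

lemma mem_pre {n : ℕ} (σ : Equiv.Perm (Fin n)) (j : ℕ) (z : Fin n) :
    z ∈ pre σ j ↔ (σ z : ℕ) < j := by simp [pre]

lemma card_pre_s16 {n : ℕ} (σ : Equiv.Perm (Fin n)) (j : ℕ) (hj : j ≤ n) : (pre σ j).card = j := by
  have h : pre σ j = (univ.filter (fun z : Fin n => (z : ℕ) < j)).map σ.symm.toEmbedding := by
    ext z
    simp only [mem_pre, mem_map, mem_filter, mem_univ, true_and, Equiv.coe_toEmbedding]
    constructor
    · intro h
      exact ⟨σ z, h, by simp⟩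
    · rintro ⟨a, ha, rfl⟩
      simpa using ha
  rw [h, card_map, Fin.card_filter_val_lt]
  omega

lemma pre_mono {n : ℕ} (σ : Equiv.Perm (Fin n)) {i j : ℕ} (h : i ≤ j) : pre σ i ⊆ pre σ j := by
  intro z hz
  rw [mem_pre] at *
  omega

lemma card_le_n {n : ℕ} (X : Finset (Fin n)) : X.card ≤ n := by
  simpa using Finset.card_le_univ X

lemma conn {n : ℕ} {β : Type*} (A C : Finset (Fin n)) (f : Finset (Fin n) → β)
    (h : ∀ X, A ⊆ X → X ⊆ C → ∀ x ∈ X, x ∉ A → ∀ y ∈ C, y ∉ X →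
      f X = f (insert y (X.erase x))) :
    ∀ (t : ℕ) (X Y : Finset (Fin n)), A ⊆ X → X ⊆ C → A ⊆ Y → Y ⊆ C → X.card = Y.card →
      (X \ Y).card = t → f X = f Y := by
  intro t
  induction t with
  | zero =>
    intro X Y _ _ _ _ hc ht
    have : X ⊆ Y := by
      rw [Finset.card_eq_zero, Finset.sdiff_eq_empty_iff_subset] at ht
      exact ht
    rw [Finset.eq_of_subset_of_card_le this hc.ge]
  | succ t ih =>
    intro X Y hAX hXC hAY hYC hc ht
    have h2 : (Y \ X).card = t + 1 := by
      rw [← ht]; exact (Finset.card_sdiff_comm hc).symm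
    obtain ⟨x, hx⟩ := Finset.card_pos.1 (by omega : 0 < (X \ Y).card)
    obtain ⟨y, hy⟩ := Finset.card_pos.1 (by omega : 0 < (Y \ X).card)
    rw [Finset.mem_sdiff] at hx hy
    have hxA : x ∉ A := fun hh => hx.2 (hAY hh)
    rw [h X hAX hXC x hx.1 hxA y (hYC hy.1) hy.2]
    have hne : y ∉ X.erase x := fun hh => hy.2 (Finset.mem_of_mem_erase hh)
    apply ih
    · intro z hz
      have : z ≠ x := by rintro rfl; exact hxA hz
      simp [this, hAX hz]
    · intro z hz
      simp only [mem_insert, mem_erase] at hz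
      rcases hz with rfl | hz
      · exact hYC hy.1
      · exact hXC hz.2
    · exact hAY
    · exact hYC
    · rw [card_insert_of_notMem hne, card_erase_of_mem hx.1, ← hc]
      have := Finset.card_pos.2 ⟨x, hx.1⟩
      omega
    · have : insert y (X.erase x) \ Y = (X \ Y).erase x := by
        ext z
        simp only [mem_sdiff, mem_insert, mem_erase]
        constructor
        · rintro ⟨rfl | h1, h2⟩
          · exact absurd hy.1 h2
          · exact ⟨h1.1, h1.2, h2⟩
        · rintro ⟨h1, h2, h3⟩
          exact ⟨Or.inr ⟨h1, h2⟩, h3⟩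
      rw [this, card_erase_of_mem (by simp [hx]), ht]
      omega

lemma pre_mul_swap {n : ℕ} (σ : Equiv.Perm (Fin n)) (X : Finset (Fin n)) (x y : Fin n)
    (hx : x ∈ X) (hy : y ∉ X) (h : pre σ X.card = X) :
    pre (σ * Equiv.swap x y) X.card = insert y (X.erase x) := by
  ext z
  have key : ∀ w, (σ w : ℕ) < X.card ↔ w ∈ X := fun w => by rw [← mem_pre, h]
  rw [mem_pre, Equiv.Perm.mul_apply, key]
  by_cases h1 : z = x
  · subst h1
    have : z ≠ y := by rintro rfl; exact hy hx
    simp [hy, this]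
  · by_cases h2 : z = y
    · subst h2; simp [hx]
    · rw [Equiv.swap_apply_of_ne_of_ne h1 h2]; simp [h1, h2]

lemma card_swapped {n : ℕ} (X : Finset (Fin n)) (x y : Fin n)
    (hx : x ∈ X) (hy : y ∉ X) : (insert y (X.erase x)).card = X.card := by
  have hne : y ∉ X.erase x := fun hh => hy (Finset.mem_of_mem_erase hh)
  rw [card_insert_of_notMem hne, card_erase_of_mem hx]
  have := Finset.card_pos.2 ⟨x, hx⟩
  omega

/-- `K` : set of chains through `A` and `C`, symmetric between. -/
structure Nice {n : ℕ} (A C : Finset (Fin n)) (K : Finset (Equiv.Perm (Fin n))) : Prop where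
  sub : A ⊆ C
  hA : ∀ σ ∈ K, pre σ A.card = A
  hC : ∀ σ ∈ K, pre σ C.card = C
  inv : ∀ σ ∈ K, ∀ x ∈ C, x ∉ A → ∀ y ∈ C, y ∉ A → σ * Equiv.swap x y ∈ K

lemma count_swap {n : ℕ} {A C : Finset (Fin n)} {K : Finset (Equiv.Perm (Fin n))}
    (hK : Nice A C K) (X : Finset (Fin n)) (hAX : A ⊆ X) (hXC : X ⊆ C) (x : Fin n) (hx : x ∈ X)
    (hxA : x ∉ A) (y : Fin n) (hy : y ∈ C) (hyX : y ∉ X) :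
    (K.filter (fun σ => pre σ X.card = X)).card =
    (K.filter (fun σ => pre σ (insert y (X.erase x)).card = insert y (X.erase x))).card := by
  have hyA : y ∉ A := fun h => hyX (hAX h)
  have hxy : x ≠ y := by rintro rfl; exact hyX hx
  apply Finset.card_bij' (fun σ _ => σ * Equiv.swap x y) (fun σ _ => σ * Equiv.swap x y)
  · intro σ hσ
    rw [mem_filter] at *
    refine ⟨hK.inv σ hσ.1 x (hXC hx) hxA y hy hyA, ?_⟩
    rw [card_swapped X x y hx hyX]
    exact pre_mul_swap σ X x y hx hyX hσ.2
  · intro σ hσ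
    rw [mem_filter] at *
    refine ⟨hK.inv σ hσ.1 x (hXC hx) hxA y hy hyA, ?_⟩
    have := pre_mul_swap σ _ y x (by simp) (by simp [hxy]) hσ.2
    rw [card_swapped X x y hx hyX] at this
    rw [Equiv.swap_comm, this]
    ext z
    simp only [mem_insert, mem_erase]
    by_cases h1 : z = x
    · subst h1; simp [hx]
    · by_cases h2 : z = y
      · subst h2; simp [hyX, h1]
      · simp [h1, h2]
  · intro σ _; simp [mul_assoc]
  · intro σ _; simp [mul_assoc]

lemma level_card {n : ℕ} (A C : Finset (Fin n)) (hAC : A ⊆ C) (j : ℕ) (h1 : A.card ≤ j) :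
    (univ.filter (fun X : Finset (Fin n) => A ⊆ X ∧ X ⊆ C ∧ X.card = j)).card =
      (C.card - A.card).choose (j - A.card) := by
  rw [← Finset.card_sdiff_of_subset hAC, ← Finset.card_powersetCard]
  apply Finset.card_bij' (fun X _ => X \ A) (fun X _ => X ∪ A)
  · intro X hX
    simp only [mem_filter, mem_univ, true_and] at hX
    rw [mem_powersetCard, Finset.card_sdiff_of_subset hX.1, hX.2.2]
    exact ⟨Finset.sdiff_subset_sdiff hX.2.1 (Finset.Subset.refl _), rfl⟩
  · intro X hX
    rw [mem_powersetCard] at hX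
    have hd : Disjoint X A := by
      rw [Finset.disjoint_left]
      intro z hz
      exact (mem_sdiff.1 (hX.1 hz)).2
    simp only [mem_filter, mem_univ, true_and]
    refine ⟨subset_union_right, union_subset (hX.1.trans sdiff_subset) hAC, ?_⟩
    rw [card_union_of_disjoint hd]; omega
  · intro X hX
    simp only [mem_filter, mem_univ, true_and] at hX
    exact sdiff_union_of_subset hX.1
  · intro X hX
    rw [mem_powersetCard] at hX
    have hd : Disjoint X A := by
      rw [Finset.disjoint_left]
      intro z hz
      exact (mem_sdiff.1 (hX.1 hz)).2
    exact union_sdiff_cancel_right hd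

lemma nice_count {n : ℕ} {A C : Finset (Fin n)} {K : Finset (Equiv.Perm (Fin n))}
    (hK : Nice A C K) (X : Finset (Fin n)) (hAX : A ⊆ X) (hXC : X ⊆ C) :
    (C.card - A.card).choose (X.card - A.card) * (K.filter (fun σ => pre σ X.card = X)).card
      = K.card := by
  rw [← level_card A C hK.sub X.card (card_le_card hAX)]
  rw [Finset.card_eq_sum_card_fiberwise (s := K) (f := fun σ => pre σ X.card)
    (t := (univ.filter (fun Y : Finset (Fin n) => A ⊆ Y ∧ Y ⊆ C ∧ Y.card = X.card)))]
  · rw [← smul_eq_mul, ← Finset.sum_const]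
    apply Finset.sum_congr rfl
    intro Y hY
    simp only [mem_filter, mem_univ, true_and] at hY
    have := conn A C (fun X => (K.filter (fun σ => pre σ X.card = X)).card)
      (fun X h1 h2 x hx hxA y hy hyX => count_swap hK X h1 h2 x hx hxA y hy hyX) _ X Y hAX hXC
      hY.1 hY.2.1 hY.2.2.symm rfl
    simp only [hY.2.2] at this
    exact this
  · intro σ hσ
    rw [mem_coe] at hσ
    rw [mem_coe, mem_filter]
    refine ⟨mem_univ _, ?_⟩
    refine ⟨?_, ?_, card_pre_s16 _ _ (card_le_n X)⟩
    · conv_lhs => rw [← hK.hA σ hσ]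
      exact pre_mono _ (card_le_card hAX)
    · conv_rhs => rw [← hK.hC σ hσ]
      exact pre_mono _ (card_le_card hXC)

/-- Lubell weight in the interval. -/
def lub {n : ℕ} (A C : Finset (Fin n)) (G : Finset (Finset (Fin n))) : ℚ :=
  ∑ X ∈ G, (((C.card - A.card).choose (X.card - A.card) : ℕ) : ℚ)⁻¹

lemma nice_sum {n : ℕ} {A C : Finset (Fin n)} {K : Finset (Equiv.Perm (Fin n))}
    (hK : Nice A C K) (G : Finset (Finset (Fin n))) (hG : ∀ X ∈ G, A ⊆ X ∧ X ⊆ C) :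
    ∑ σ ∈ K, ((onc G σ).card : ℚ) = K.card * lub A C G := by
  have : ∑ σ ∈ K, (onc G σ).card = ∑ X ∈ G, (K.filter (fun σ => pre σ X.card = X)).card := by
    simp only [onc, Finset.card_filter]
    rw [Finset.sum_comm]
  rw [← Nat.cast_sum, this, lub, Nat.cast_sum, Finset.mul_sum]
  apply Finset.sum_congr rfl
  intro X hX
  obtain ⟨h1, h2⟩ := hG X hX
  rw [← nice_count hK X h1 h2]
  have : (((C.card - A.card).choose (X.card - A.card) : ℕ) : ℚ) ≠ 0 := by
    have := Nat.choose_pos (Nat.sub_le_sub_right (card_le_card h2) A.card)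
    positivity
  push_cast
  field_simp

lemma le_choose_mid : ∀ (N i : ℕ), 0 < i → i < N → N ≤ N.choose i := by
  intro N
  induction N with
  | zero => intro i _ h; omega
  | succ N ih =>
    intro i h0 h1
    obtain ⟨i, rfl⟩ : ∃ j, i = j + 1 := ⟨i - 1, by omega⟩
    rw [Nat.choose_succ_succ']
    by_cases h2 : i + 1 = N
    · subst h2
      simp
    · have h3 := ih (i + 1) (by omega) (by omega)
      have h4 : 0 < N.choose i := Nat.choose_pos (by omega)
      omega

lemma onc_card_inj {n : ℕ} (G : Finset (Finset (Fin n))) (σ : Equiv.Perm (Fin n)) :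
    Set.InjOn Finset.card (onc G σ : Set (Finset (Fin n))) := by
  intro X hX Y hY h
  simp only [onc, coe_filter] at hX hY
  rw [← hX.2, ← hY.2, h]

lemma lub_onc_lt {n : ℕ} (A C : Finset (Fin n)) (G : Finset (Finset (Fin n)))
    (hG : ∀ X ∈ G, A ⊂ X ∧ X ⊂ C) (σ : Equiv.Perm (Fin n)) : lub A C (onc G σ) < 1 := by
  rcases (onc G σ).eq_empty_or_nonempty with h | ⟨X0, hX0⟩
  · rw [h]; simp [lub]
  have hb : ∀ X ∈ onc G σ, A.card < X.card ∧ X.card < C.card := fun X hX =>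
    ⟨card_lt_card (hG X (mem_filter.1 hX).1).1, card_lt_card (hG X (mem_filter.1 hX).1).2⟩
  have hN := hb X0 hX0
  have hc : (onc G σ).card ≤ C.card - A.card - 1 := by
    rw [← Nat.card_Ioo, ← Finset.card_image_of_injOn (onc_card_inj G σ)]
    apply card_le_card
    intro j hj
    obtain ⟨X, hX, rfl⟩ := mem_image.1 hj
    exact mem_Ioo.2 (hb X hX)
  set N := C.card - A.card with hNdef
  have hNpos : (0 : ℚ) < N := by
    have : 0 < N := by omega
    exact_mod_cast this
  have : lub A C (onc G σ) ≤ ∑ X ∈ onc G σ, (N : ℚ)⁻¹ := by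
    apply Finset.sum_le_sum
    intro X hX
    have h := hb X hX
    have := le_choose_mid N (X.card - A.card) (by omega) (by omega)
    apply inv_anti₀ hNpos
    exact_mod_cast this
  refine this.trans_lt ?_
  rw [sum_const, nsmul_eq_mul, ← div_eq_mul_inv, div_lt_one hNpos]
  have : (onc G σ).card < N := by omega
  exact_mod_cast this

lemma exists_chain {n : ℕ} (G : Finset (Finset (Fin n))) (σ : Equiv.Perm (Fin n)) (d : ℕ)
    (h : d ≤ (onc G σ).card) : ∃ S : ℕ → Finset (Fin n),
      (∀ j < d, S j ∈ onc G σ) ∧ (∀ j, j + 1 < d → S j ⊆ S (j + 1)) ∧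
      (∀ j < d, ∀ j' < d, j ≠ j' → S j ≠ S j') := by
  rw [← Finset.card_image_of_injOn (onc_card_inj G σ)] at h
  set T := (onc G σ).image Finset.card
  let e := T.orderEmbOfCardLe h
  have he : ∀ j, ∃ X ∈ onc G σ, X.card = e j := fun j =>
    mem_image.1 (T.orderEmbOfCardLe_mem h j)
  have hS : ∀ j (hj : j < d), pre σ (e ⟨j, hj⟩) ∈ onc G σ ∧
      (pre σ (e ⟨j, hj⟩)).card = e ⟨j, hj⟩ := by
    intro j hj
    obtain ⟨X, hX, hc⟩ := he ⟨j, hj⟩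
    rw [← hc, (mem_filter.1 hX).2]
    exact ⟨hX, rfl⟩
  refine ⟨fun j => if hj : j < d then pre σ (e ⟨j, hj⟩) else ∅, ?_, ?_, ?_⟩
  · intro j hj
    simp only [hj, dif_pos]
    exact (hS j hj).1
  · intro j hj
    have hj' : j < d := by omega
    simp only [hj, hj', dif_pos]
    apply pre_mono
    exact e.monotone (by simp)
  · intro j hj j' hj' hne
    simp only [hj, hj', dif_pos]
    intro h
    have h2 := congrArg Finset.card h
    rw [(hS j hj).2, (hS j' hj').2] at h2
    have := e.injective h2
    simp at this
    exact hne this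

lemma exists_big {n : ℕ} {A C : Finset (Fin n)} {K : Finset (Equiv.Perm (Fin n))}
    (hK : Nice A C K) (hne : K.Nonempty) (G : Finset (Finset (Fin n)))
    (hG : ∀ X ∈ G, A ⊆ X ∧ X ⊆ C) (d : ℕ) (h : (d : ℚ) - 1 < lub A C G) :
    ∃ σ ∈ K, d ≤ (onc G σ).card := by
  by_contra! hcon
  have h1 : ∑ σ ∈ K, ((onc G σ).card : ℚ) ≤ ∑ σ ∈ K, ((d : ℚ) - 1) := by
    apply Finset.sum_le_sum
    intro σ hσ
    have := hcon σ hσ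
    have : (((onc G σ).card + 1 : ℕ) : ℚ) ≤ d := by exact_mod_cast this
    push_cast at this
    linarith
  rw [nice_sum hK G hG, sum_const, nsmul_eq_mul] at h1
  have hp : (0 : ℚ) < K.card := by exact_mod_cast hne.card_pos
  have := mul_lt_mul_of_pos_left h hp
  linarith

lemma exists_system {n : ℕ} {A C : Finset (Fin n)} {K : Finset (Equiv.Perm (Fin n))}
    (hK : Nice A C K) (hne : K.Nonempty) : ∀ (k : ℕ) (d : Fin k → ℕ), StrictAnti d →
    ∀ (G : Finset (Finset (Fin n))), (∀ X ∈ G, A ⊂ X ∧ X ⊂ C) →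
    (∀ h : 0 < k, (d ⟨0, h⟩ : ℚ) - 1 ≤ lub A C G ∧ ∃ σ ∈ K, d ⟨0, h⟩ ≤ (onc G σ).card) →
    ∃ S : Fin k → ℕ → Finset (Fin n), (∀ i, ∀ j < d i, S i j ∈ G) ∧
      (∀ i, ∀ j, j + 1 < d i → S i j ⊆ S i (j + 1)) ∧
      (∀ i, ∀ j < d i, ∀ i', ∀ j' < d i', (i, j) ≠ (i', j') → S i j ≠ S i' j') := by
  intro k
  induction k with
  | zero =>
    intro d _ G _ _
    exact ⟨fun _ _ => ∅, fun i => i.elim0, fun i => i.elim0, fun i => i.elim0⟩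
  | succ k ih =>
    intro d hd G hG h
    obtain ⟨h1, σ, hσ, h2⟩ := h (Nat.succ_pos k)
    change (d 0 : ℚ) - 1 ≤ _ at h1
    change d 0 ≤ _ at h2
    obtain ⟨S0, hS0, hS0c, hS0d⟩ := exists_chain G σ (d 0) h2
    let G' := G.filter (fun X => ¬ pre σ X.card = X)
    have hG' : ∀ X ∈ G', A ⊂ X ∧ X ⊂ C := fun X hX => hG X (mem_filter.1 hX).1
    have hsum : lub A C G = lub A C (onc G σ) + lub A C G' := by
      unfold lub onc
      exact (Finset.sum_filter_add_sum_filter_not _ _ _).symm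
    have hlt := lub_onc_lt A C G hG σ
    obtain ⟨S, hS, hSc, hSd⟩ := ih (fun i => d i.succ)
      (fun i j hij => hd (Fin.succ_lt_succ_iff.2 hij)) G' hG' (by
        intro hk
        have hlt2 : d (Fin.succ ⟨0, hk⟩) < d 0 := hd (Fin.succ_pos _)
        have hlt3 : ((d (Fin.succ ⟨0, hk⟩) + 1 : ℕ) : ℚ) ≤ d 0 := by exact_mod_cast hlt2
        push_cast at hlt3
        have hlt4 : (d (Fin.succ ⟨0, hk⟩) : ℚ) - 1 < lub A C G' := by linarith
        exact ⟨hlt4.le, exists_big hK hne G' (fun X hX => ⟨(hG' X hX).1.1, (hG' X hX).2.1⟩) _ hlt4⟩)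
    have hdisj : ∀ j < d 0, ∀ (i' : Fin k), ∀ j' < d i'.succ, S0 j ≠ S i' j' := by
      intro j hj i' j' hj' he
      have h3 := (mem_filter.1 (hS i' j' hj')).2
      rw [← he] at h3
      exact h3 (mem_filter.1 (hS0 j hj)).2
    refine ⟨Fin.cons S0 S, ?_, ?_, ?_⟩
    · intro i
      refine Fin.cases ?_ (fun i => ?_) i
      · intro j hj
        exact (mem_filter.1 (hS0 j hj)).1
      · intro j hj
        exact (mem_filter.1 (hS i j hj)).1
    · intro i
      refine Fin.cases ?_ (fun i => ?_) i
      · exact hS0c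
      · exact hSc i
    · intro i
      refine Fin.cases ?_ (fun i => ?_) i
      · intro j hj i'
        refine Fin.cases ?_ (fun i' => ?_) i'
        · intro j' hj' hne'
          exact hS0d j hj j' hj' (fun hh => hne' (by rw [hh]))
        · intro j' hj' _
          exact hdisj j hj i' j' hj'
      · intro j hj i'
        refine Fin.cases ?_ (fun i' => ?_) i'
        · intro j' hj' _
          exact (hdisj j' hj' i j hj).symm
        · intro j' hj' hne'
          refine hSd i j hj i' j' hj' (fun hh => hne' ?_)
          rw [Prod.mk.injEq] at hh ⊢
          exact ⟨by rw [hh.1], hh.2⟩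

lemma harp_of_class {n k : ℕ} (hk : 1 ≤ k) (l : Fin k → ℕ) (hdec : StrictAnti l)
    (hl : ∀ i, 3 ≤ l i) (F : Finset (Finset (Fin n)))
    {A C : Finset (Fin n)} {K : Finset (Equiv.Perm (Fin n))}
    (hK : Nice A C K) (hne : K.Nonempty) (hA : A ∈ F) (hC : C ∈ F) (hAC : A ≠ C)
    (h1 : (l ⟨0, by omega⟩ : ℚ) - 3 ≤ lub A C (F.filter (fun X => A ⊂ X ∧ X ⊂ C)))
    (h2 : ∃ σ ∈ K, l ⟨0, by omega⟩ - 2 ≤ (onc (F.filter (fun X => A ⊂ X ∧ X ⊂ C)) σ).card) :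
    ContainsHarp n l F := by
  obtain ⟨S, hS, hSc, hSd⟩ := exists_system hK hne k (fun i => l i - 2)
    (fun i j hij => by have := hdec hij; have := hl j; simp only; omega)
    (F.filter (fun X => A ⊂ X ∧ X ⊂ C)) (fun X hX => (mem_filter.1 hX).2) (fun h => by
      refine ⟨?_, h2⟩
      have := hl ⟨0, h⟩
      rw [Nat.cast_sub (by omega)]
      push_cast
      linarith)
  have hm : ∀ i, ∀ j < l i - 2, S i j ∈ F ∧ A ⊂ S i j ∧ S i j ⊂ C := fun i j hj =>
    mem_filter.1 (hS i j hj)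
  refine ⟨A, C, S, hA, hC, hAC, fun i j hj => (hm i j hj).1, hSc, ?_, ?_, ?_, hSd⟩
  · intro i
    have := hl i
    exact (hm i 0 (by omega)).2.1.1
  · intro i
    have := hl i
    exact (hm i (l i - 3) (by omega)).2.2.1
  · intro i j hj
    exact ⟨(hm i j hj).2.1.ne', (hm i j hj).2.2.ne⟩

lemma onc_chain {n : ℕ} {σ : Equiv.Perm (Fin n)} {X Y : Finset (Fin n)}
    (hX : pre σ X.card = X) (hY : pre σ Y.card = Y) : X ⊆ Y ∨ Y ⊆ X := by
  rcases le_total X.card Y.card with h | h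
  · left; rw [← hX, ← hY]; exact pre_mono σ h
  · right; rw [← hX, ← hY]; exact pre_mono σ h

/-- The class of chains with smallest member `A` and largest member `C`. -/
def cls {n : ℕ} (F : Finset (Finset (Fin n))) (A C : Finset (Fin n)) :
    Finset (Equiv.Perm (Fin n)) :=
  univ.filter (fun σ => A ∈ onc F σ ∧ C ∈ onc F σ ∧ ∀ X ∈ onc F σ, A ⊆ X ∧ X ⊆ C)

lemma pre_swap_same {n : ℕ} (σ : Equiv.Perm (Fin n)) (X : Finset (Fin n)) (j : ℕ) (x y : Fin n)
    (h : x ∈ X ↔ y ∈ X) : pre (σ * Equiv.swap x y) j = X ↔ pre σ j = X := by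
  have key : ∀ ρ : Equiv.Perm (Fin n), pre ρ j = X → pre (ρ * Equiv.swap x y) j = X := by
    intro ρ hρ
    ext z
    rw [mem_pre, Equiv.Perm.mul_apply, ← mem_pre, hρ]
    by_cases h1 : z = x
    · subst h1; simp [h]
    · by_cases h2 : z = y
      · subst h2; simp [h]
      · rw [Equiv.swap_apply_of_ne_of_ne h1 h2]
  refine ⟨fun hh => ?_, key σ⟩
  have := key _ hh
  simpa [mul_assoc] using this

lemma cls_nice {n : ℕ} (F : Finset (Finset (Fin n))) (A C : Finset (Fin n)) (hAC : A ⊆ C) :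
    Nice A C (cls F A C) := by
  refine ⟨hAC, ?_, ?_, ?_⟩
  · intro σ hσ
    exact (mem_filter.1 (mem_filter.1 hσ).2.1).2
  · intro σ hσ
    exact (mem_filter.1 (mem_filter.1 hσ).2.2.1).2
  · intro σ hσ x hx hxA y hy hyA
    obtain ⟨-, h1, h2, h3⟩ := mem_filter.1 hσ
    have g1 := mem_filter.1 h1
    have g2 := mem_filter.1 h2
    have hA' : pre (σ * Equiv.swap x y) A.card = A :=
      (pre_swap_same σ A _ x y (by simp [hxA, hyA])).2 g1.2
    have hC' : pre (σ * Equiv.swap x y) C.card = C :=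
      (pre_swap_same σ C _ x y (by simp [hx, hy])).2 g2.2
    refine mem_filter.2 ⟨mem_univ _, mem_filter.2 ⟨g1.1, hA'⟩, mem_filter.2 ⟨g2.1, hC'⟩, ?_⟩
    intro X hX
    obtain ⟨hXF, hX⟩ := mem_filter.1 hX
    constructor
    · rcases onc_chain hA' hX with h | h
      · exact h
      · have hh := (pre_swap_same σ X _ x y
          (by simp [show x ∉ X from fun t => hxA (h t), show y ∉ X from fun t => hyA (h t)])).1 hX
        exact (h3 X (mem_filter.2 ⟨hXF, hh⟩)).1
    · rcases onc_chain hC' hX with h | h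
      · have hh := (pre_swap_same σ X _ x y (by simp [h hx, h hy])).1 hX
        exact (h3 X (mem_filter.2 ⟨hXF, hh⟩)).2
      · exact h

lemma cls_bound {n k : ℕ} (hk : 1 ≤ k) (l : Fin k → ℕ) (hdec : StrictAnti l)
    (hl : ∀ i, 3 ≤ l i) (F : Finset (Finset (Fin n))) (hF : HarpFree n l F)
    (A C : Finset (Fin n)) (hAC : A ⊂ C) :
    0 ≤ ∑ σ ∈ cls F A C, ((l ⟨0, by omega⟩ : ℚ) - 1 - (onc F σ).card) ∧
    (∑ σ ∈ cls F A C, ((l ⟨0, by omega⟩ : ℚ) - 1 - (onc F σ).card) = 0 →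
      ∀ σ ∈ cls F A C, ((l ⟨0, by omega⟩ : ℚ) - 1 - (onc F σ).card) = 0) := by
  rcases (cls F A C).eq_empty_or_nonempty with he | hne
  · rw [he]; simp
  have hN := cls_nice F A C hAC.1
  set G := F.filter (fun X => A ⊂ X ∧ X ⊂ C) with hG
  have hcard : ∀ σ ∈ cls F A C, (onc F σ).card = (onc G σ).card + 2 := by
    intro σ hσ
    obtain ⟨-, h1, h2, h3⟩ := mem_filter.1 hσ
    have : onc F σ = insert A (insert C (onc G σ)) := by
      ext X
      simp only [mem_insert]
      constructor
      · intro hX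
        by_cases hXA : X = A
        · exact Or.inl hXA
        by_cases hXC : X = C
        · exact Or.inr (Or.inl hXC)
        right; right
        obtain ⟨g1, g2⟩ := h3 X hX
        refine mem_filter.2 ⟨mem_filter.2 ⟨(mem_filter.1 hX).1, ?_, ?_⟩, (mem_filter.1 hX).2⟩
        · exact Finset.ssubset_iff_subset_ne.2 ⟨g1, Ne.symm hXA⟩
        · exact Finset.ssubset_iff_subset_ne.2 ⟨g2, hXC⟩
      · rintro (rfl | rfl | hX)
        · exact h1
        · exact h2
        · exact mem_filter.2 ⟨(mem_filter.1 (mem_filter.1 hX).1).1, (mem_filter.1 hX).2⟩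
    have hCn : C ∉ onc G σ := fun h => (mem_filter.1 (mem_filter.1 h).1).2.2.ne rfl
    have hAn : A ∉ onc G σ := fun h => (mem_filter.1 (mem_filter.1 h).1).2.1.ne rfl
    rw [this, card_insert_of_notMem, card_insert_of_notMem hCn]
    simp [hAn, hAC.ne]
  obtain ⟨σ0, hσ0⟩ := hne
  have hAF : A ∈ F := (mem_filter.1 (mem_filter.1 hσ0).2.1).1
  have hCF : C ∈ F := (mem_filter.1 (mem_filter.1 hσ0).2.2.1).1
  by_cases hbig : ∃ σ ∈ cls F A C, l ⟨0, by omega⟩ - 2 ≤ (onc G σ).card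
  · have hlub : lub A C G < (l ⟨0, by omega⟩ : ℚ) - 3 := by
      by_contra! hcon
      exact hF (harp_of_class hk l hdec hl F hN ⟨σ0, hσ0⟩ hAF hCF hAC.ne hcon hbig)
    have hsum : ∑ σ ∈ cls F A C, ((l ⟨0, by omega⟩ : ℚ) - 1 - (onc F σ).card) =
        (cls F A C).card * ((l ⟨0, by omega⟩ : ℚ) - 3 - lub A C G) := by
      rw [mul_sub, ← nice_sum hN G (fun X hX => ⟨(mem_filter.1 hX).2.1.1, (mem_filter.1 hX).2.2.1⟩),
        ← nsmul_eq_mul, ← sum_const, ← sum_sub_distrib]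
      apply sum_congr rfl
      intro σ hσ
      rw [hcard σ hσ]
      push_cast
      ring
    have hp : (0 : ℚ) < (cls F A C).card := by exact_mod_cast card_pos.2 ⟨σ0, hσ0⟩
    have : 0 < (cls F A C).card * ((l ⟨0, by omega⟩ : ℚ) - 3 - lub A C G) :=
      mul_pos hp (by linarith)
    rw [hsum]
    exact ⟨this.le, fun h => absurd h this.ne'⟩
  · push Not at hbig
    have hnn : ∀ σ ∈ cls F A C, 0 ≤ ((l ⟨0, by omega⟩ : ℚ) - 1 - (onc F σ).card) := by
      intro σ hσ
      have h1 := hbig σ hσ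
      have h2 := hcard σ hσ
      have h3 : (onc F σ).card + 1 ≤ l ⟨0, by omega⟩ := by omega
      have h4 : (((onc F σ).card + 1 : ℕ) : ℚ) ≤ l ⟨0, by omega⟩ := by exact_mod_cast h3
      push_cast at h4
      linarith
    exact ⟨sum_nonneg hnn, fun h => (sum_eq_zero_iff_of_nonneg hnn).1 h⟩

/-- smallest and largest members of `F` on the chain -/
def ends {n : ℕ} (F : Finset (Finset (Fin n))) (σ : Equiv.Perm (Fin n)) :
    Finset (Fin n) × Finset (Fin n) :=
  ((onc F σ).inf id, (onc F σ).sup id)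

lemma ends_mem {n : ℕ} (F : Finset (Finset (Fin n))) (σ : Equiv.Perm (Fin n))
    (h : (onc F σ).Nonempty) : (ends F σ).1 ∈ onc F σ ∧ (ends F σ).2 ∈ onc F σ := by
  constructor
  · obtain ⟨X, hX, hmin⟩ := exists_min_image (onc F σ) Finset.card h
    have : (ends F σ).1 = X := by
      apply le_antisymm
      · exact Finset.inf_le (f := id) hX
      · apply Finset.le_inf
        intro Y hY
        have h1 := (mem_filter.1 hX).2
        have h2 := (mem_filter.1 hY).2
        change X ⊆ Y
        rw [← h1, ← h2]
        exact pre_mono σ (hmin Y hY)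
    rw [this]; exact hX
  · obtain ⟨X, hX, hmax⟩ := exists_max_image (onc F σ) Finset.card h
    have : (ends F σ).2 = X := by
      apply le_antisymm
      · apply Finset.sup_le
        intro Y hY
        have h1 := (mem_filter.1 hX).2
        have h2 := (mem_filter.1 hY).2
        change Y ⊆ X
        rw [← h1, ← h2]
        exact pre_mono σ (hmax Y hY)
      · exact Finset.le_sup (f := id) hX
    rw [this]; exact hX

lemma ends_le {n : ℕ} (F : Finset (Finset (Fin n))) (σ : Equiv.Perm (Fin n)) :
    ∀ X ∈ onc F σ, (ends F σ).1 ⊆ X ∧ X ⊆ (ends F σ).2 := fun X hX =>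
  ⟨Finset.inf_le (f := id) hX, Finset.le_sup (f := id) hX⟩

lemma fibre_eq {n : ℕ} (F : Finset (Finset (Fin n))) (A C : Finset (Fin n)) (hAC : A ⊂ C) :
    univ.filter (fun σ => ends F σ = (A, C)) = cls F A C := by
  ext σ
  simp only [cls, mem_filter, mem_univ, true_and]
  constructor
  · intro h
    have hne : (onc F σ).Nonempty := by
      by_contra hcon
      rw [not_nonempty_iff_eq_empty] at hcon
      rw [ends, hcon, Prod.mk.injEq] at h
      simp at h
      rw [← h.1, ← h.2] at hAC
      simp at hAC
    have h1 := ends_mem F σ hne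
    have h2 := ends_le F σ
    rw [h] at h1 h2
    exact ⟨h1.1, h1.2, h2⟩
  · rintro ⟨h1, h2, h3⟩
    have g1 := ends_mem F σ ⟨A, h1⟩
    have g2 := ends_le F σ
    apply Prod.ext
    · exact Finset.Subset.antisymm (g2 A h1).1 (h3 _ g1.1).1
    · exact Finset.Subset.antisymm (h3 _ g1.2).2 (g2 C h2).2

lemma chains_eq {n k : ℕ} (hk : 1 ≤ k) (l : Fin k → ℕ) (hdec : StrictAnti l)
    (hl : ∀ i, 3 ≤ l i) (F : Finset (Finset (Fin n))) (hF : HarpFree n l F)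
    (htot : ∑ σ : Equiv.Perm (Fin n), ((l ⟨0, by omega⟩ : ℚ) - 1 - (onc F σ).card) ≤ 0) :
    ∀ σ : Equiv.Perm (Fin n), (onc F σ).card = l ⟨0, by omega⟩ - 1 := by
  have hl0 : (3 : ℚ) ≤ l ⟨0, by omega⟩ := by exact_mod_cast hl _
  have hfib : ∀ p : Finset (Fin n) × Finset (Fin n),
    0 ≤ ∑ σ ∈ univ.filter (fun σ => ends F σ = p), ((l ⟨0, by omega⟩ : ℚ) - 1 - (onc F σ).card) ∧
    (∑ σ ∈ univ.filter (fun σ => ends F σ = p), ((l ⟨0, by omega⟩ : ℚ) - 1 - (onc F σ).card) = 0 →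
      ∀ σ ∈ univ.filter (fun σ => ends F σ = p),
        ((l ⟨0, by omega⟩ : ℚ) - 1 - (onc F σ).card) = 0) := by
    rintro ⟨A, C⟩
    by_cases hAC : A ⊂ C
    · rw [fibre_eq F A C hAC]
      exact cls_bound hk l hdec hl F hF A C hAC
    · have hnn : ∀ σ ∈ univ.filter (fun σ => ends F σ = (A, C)),
          0 ≤ ((l ⟨0, by omega⟩ : ℚ) - 1 - (onc F σ).card) := by
        intro σ hσ
        have he := (mem_filter.1 hσ).2
        have : (onc F σ).card ≤ 1 := by
          rw [Finset.card_le_one]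
          have h2 := ends_le F σ
          rw [he] at h2
          have hh : ∀ X ∈ onc F σ, X = A := by
            intro X hX
            obtain ⟨a, b⟩ := h2 X hX
            have hCA : C ⊆ A := by
              by_contra hcon
              exact hAC ⟨a.trans b, hcon⟩
            exact Finset.Subset.antisymm (b.trans hCA) a
          intro X hX Y hY
          rw [hh X hX, hh Y hY]
        have : ((onc F σ).card : ℚ) ≤ 1 := by exact_mod_cast this
        linarith
      exact ⟨sum_nonneg hnn, fun h => (sum_eq_zero_iff_of_nonneg hnn).1 h⟩
  rw [← Finset.sum_fiberwise univ (ends F)] at htot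
  have hz := le_antisymm htot (sum_nonneg (fun p _ => (hfib p).1))
  have hz2 := (sum_eq_zero_iff_of_nonneg (fun p _ => (hfib p).1)).1 hz
  intro σ
  have := (hfib (ends F σ)).2 (hz2 _ (mem_univ _)) σ (by simp)
  have h3 : ((l ⟨0, by omega⟩ : ℕ) : ℚ) = (((onc F σ).card + 1 : ℕ) : ℚ) := by
    push_cast; linarith
  have := Nat.cast_injective h3
  omega

lemma nice_univ (n : ℕ) : Nice (∅ : Finset (Fin n)) univ univ := by
  refine ⟨by simp, ?_, ?_, by simp⟩
  · intro σ _
    ext z; simp [mem_pre]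
  · intro σ _
    ext z; simp [mem_pre]

lemma exists_through {n : ℕ} (X : Finset (Fin n)) : ∃ σ : Equiv.Perm (Fin n), pre σ X.card = X := by
  have h := nice_count (nice_univ n) X (by simp) (by simp)
  by_contra! hcon
  have h2 : (univ.filter (fun σ : Equiv.Perm (Fin n) => pre σ X.card = X)) = ∅ := by
    ext σ; simp [hcon σ]
  rw [h2, card_empty, card_empty, mul_zero] at h
  have := card_pos.2 (univ_nonempty (α := Equiv.Perm (Fin n)))
  omega

lemma pre_left_swap {n : ℕ} (σ : Equiv.Perm (Fin n)) (i : ℕ) (a b : Fin n)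
    (h : (a : ℕ) < i ↔ (b : ℕ) < i) : pre (Equiv.swap a b * σ) i = pre σ i := by
  ext z
  rw [mem_pre, mem_pre, Equiv.Perm.mul_apply]
  by_cases h1 : σ z = a
  · rw [h1, Equiv.swap_apply_left, h]
  · by_cases h2 : σ z = b
    · rw [h2, Equiv.swap_apply_right, h]
    · rw [Equiv.swap_apply_of_ne_of_ne h1 h2]

lemma exists_through_two {n : ℕ} (X : Finset (Fin n)) (x y : Fin n) (hx : x ∈ X) (hy : y ∉ X) :
    ∃ σ : Equiv.Perm (Fin n), pre σ X.card = X ∧ (σ x : ℕ) + 1 = X.card ∧ (σ y : ℕ) = X.card := by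
  obtain ⟨σ0, h0⟩ := exists_through X
  have hpos : 0 < X.card := card_pos.2 ⟨x, hx⟩
  have hx0 : (σ0 x : ℕ) < X.card := by rw [← mem_pre, h0]; exact hx
  have hy0 : ¬ (σ0 y : ℕ) < X.card := by rw [← mem_pre, h0]; exact hy
  have hlt : X.card < n := by have := (σ0 y).2; omega
  let a : Fin n := ⟨X.card - 1, by omega⟩
  let b : Fin n := ⟨X.card, hlt⟩
  let σ1 := Equiv.swap (σ0 x) a * σ0
  have h1 : pre σ1 X.card = X := by
    rw [pre_left_swap _ _ _ _ (by simp only [hx0, a, true_iff]; omega), h0]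
  have hx1 : σ1 x = a := by simp [σ1]
  have hy1 : ¬ (σ1 y : ℕ) < X.card := by rw [← mem_pre, h1]; exact hy
  have h2 : pre (Equiv.swap (σ1 y) b * σ1) X.card = X := by
    rw [pre_left_swap _ _ _ _ (by simp only [hy1, b, false_iff]; omega), h1]
  refine ⟨_, h2, ?_, ?_⟩
  · rw [Equiv.Perm.mul_apply, hx1, Equiv.swap_apply_of_ne_of_ne]
    · simp only [a]; omega
    · intro h; rw [← h] at hy1; simp only [a] at hy1; omega
    · intro h; have := congrArg Fin.val h; simp only [a, b] at this; omega
  · simp [b]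

lemma onc_card {n : ℕ} (F : Finset (Finset (Fin n))) (σ : Equiv.Perm (Fin n)) :
    (onc F σ).card = ((range (n + 1)).filter (fun j => pre σ j ∈ F)).card := by
  apply Finset.card_bij' (fun X _ => X.card) (fun j _ => pre σ j)
  · intro X hX
    obtain ⟨h1, h2⟩ := mem_filter.1 hX
    have := card_le_n X
    refine mem_filter.2 ⟨mem_range.2 (by omega), ?_⟩
    rw [h2]; exact h1
  · intro j hj
    obtain ⟨h1, h2⟩ := mem_filter.1 hj
    rw [mem_range] at h1
    refine mem_filter.2 ⟨h2, ?_⟩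
    rw [card_pre_s16 σ j (by omega)]
  · intro X hX
    exact (mem_filter.1 hX).2
  · intro j hj
    obtain ⟨h1, h2⟩ := mem_filter.1 hj
    rw [mem_range] at h1
    exact card_pre_s16 σ j (by omega)

lemma mem_transfer {n : ℕ} (F : Finset (Finset (Fin n))) (σ ρ : Equiv.Perm (Fin n)) (i : ℕ)
    (hi : i ≤ n) (hj : ∀ j, j ≠ i → pre ρ j = pre σ j) (hc : (onc F σ).card = (onc F ρ).card)
    (h : pre σ i ∈ F) : pre ρ i ∈ F := by
  by_contra hcon
  rw [onc_card, onc_card] at hc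
  have : (range (n + 1)).filter (fun j => pre ρ j ∈ F) ⊂
      (range (n + 1)).filter (fun j => pre σ j ∈ F) := by
    rw [Finset.ssubset_iff_of_subset]
    · exact ⟨i, mem_filter.2 ⟨mem_range.2 (by omega), h⟩, fun hh => hcon (mem_filter.1 hh).2⟩
    · intro j hh
      obtain ⟨h1, h2⟩ := mem_filter.1 hh
      have hne : j ≠ i := by rintro rfl; exact hcon h2
      rw [hj j hne] at h2
      exact mem_filter.2 ⟨h1, h2⟩
  have := card_lt_card this
  omega

lemma levels {n m : ℕ} (F : Finset (Finset (Fin n)))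
    (hall : ∀ σ : Equiv.Perm (Fin n), (onc F σ).card = m) (X Y : Finset (Fin n))
    (hXY : X.card = Y.card) (hX : X ∈ F) : Y ∈ F := by
  have := conn (∅ : Finset (Fin n)) univ (fun X => X ∈ F) (by
    intro X _ _ x hx _ y _ hy
    obtain ⟨σ, h1, h2, h3⟩ := exists_through_two X x y hx hy
    have h4 := pre_mul_swap σ X x y hx hy h1
    have hj : ∀ j, j ≠ X.card → pre (σ * Equiv.swap x y) j = pre σ j := by
      intro j hj
      rw [pre_swap_same]
      rw [mem_pre, mem_pre]
      omega
    have hc : (onc F σ).card = (onc F (σ * Equiv.swap x y)).card := by rw [hall, hall]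
    apply propext
    constructor
    · intro h
      rw [← h4]
      exact mem_transfer F σ _ X.card (card_le_n X) hj hc (by rw [h1]; exact h)
    · intro h
      rw [← h1]
      exact mem_transfer F _ σ X.card (card_le_n X) (fun j hh => (hj j hh).symm) hc.symm
        (by rw [h4]; exact h)) _ X Y (by simp) (by simp) (by simp) (by simp) hXY rfl
  exact this ▸ hX

lemma choose_step (n j : ℕ) (h : 2 * j + 1 < n) : n.choose j < n.choose (j + 1) := by
  have h1 := Nat.choose_succ_right_eq n j
  have h2 : 0 < n.choose j := Nat.choose_pos (by omega)
  by_contra! hcon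
  have h3 : n.choose (j + 1) * (j + 1) ≤ n.choose j * (j + 1) := Nat.mul_le_mul_right _ hcon
  have h4 : n.choose j * (j + 1) < n.choose j * (n - j) := Nat.mul_lt_mul_of_pos_left (by omega) h2
  omega

lemma choose_half (n i : ℕ) : ∀ t, 2 * (i + t + 1) ≤ n → n.choose i < n.choose (i + t + 1) := by
  intro t
  induction t with
  | zero => intro h; exact choose_step n i (by omega)
  | succ t ih =>
    intro h
    exact (ih (by omega)).trans (choose_step n (i + t + 1) (by omega))

lemma choose_strict (n i j : ℕ) (h1 : i < j) (h2 : i + j < n) : n.choose i < n.choose j := by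
  by_cases h : 2 * j ≤ n
  · obtain ⟨t, rfl⟩ : ∃ t, j = i + t + 1 := ⟨j - i - 1, by omega⟩
    exact choose_half n i t h
  · rw [← Nat.choose_symm (show j ≤ n by omega)]
    obtain ⟨t, ht⟩ : ∃ t, n - j = i + t + 1 := ⟨n - j - i - 1, by omega⟩
    rw [ht]
    exact choose_half n i t (by omega)

lemma sum_card_univ (n : ℕ) (f : ℕ → ℚ) :
    ∑ X : Finset (Fin n), f X.card = ∑ i ∈ range (n + 1), (n.choose i : ℚ) * f i := by
  have := Finset.sum_powerset_apply_card f (x := (univ : Finset (Fin n)))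
  simpa using this

lemma lo_facts (n m lo : ℕ) (hm : m ≤ n) (hm2 : 2 ≤ m) (hlo : lo = (n - m + 1) / 2) (i : ℕ)
    (hi : i ≤ n) :
    (lo < i → i < n - lo → n.choose lo < n.choose i) ∧
    (i < lo ∨ n - lo < i → n.choose i < n.choose lo) ∧
    (i = lo ∨ i = n - lo → n.choose i = n.choose lo) := by
  refine ⟨fun h1 h2 => choose_strict n lo i h1 (by omega), ?_, ?_⟩
  · rintro (h | h)
    · exact choose_strict n i lo h (by omega)
    · rw [← Nat.choose_symm hi]
      exact choose_strict n (n - i) lo (by omega) (by omega)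
  · rintro (h | h)
    · rw [h]
    · rw [h, Nat.choose_symm (by omega)]

lemma Blow_sum (n m : ℕ) (hm : m ≤ n) (hm2 : 2 ≤ m) (f : ℕ → ℚ) :
    ∑ X ∈ Blow n m, f X.card =
      ∑ i ∈ range m, (n.choose ((n - m + 1) / 2 + i) : ℚ) * f ((n - m + 1) / 2 + i) := by
  have h1 : ∑ X ∈ Blow n m, f X.card = ∑ X : Finset (Fin n),
      (fun i => if (n - m + 1) / 2 ≤ i ∧ i ≤ (n + m - 1) / 2 then f i else 0) X.card := by
    rw [Blow, sum_filter]
  rw [h1, sum_card_univ n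
    (fun i => if (n - m + 1) / 2 ≤ i ∧ i ≤ (n + m - 1) / 2 then f i else 0)]
  simp only [mul_ite, mul_zero]
  rw [← sum_filter]
  have h2 : (range (n + 1)).filter (fun i => (n - m + 1) / 2 ≤ i ∧ i ≤ (n + m - 1) / 2) =
      Ico ((n - m + 1) / 2) ((n - m + 1) / 2 + m) := by
    ext i
    simp only [mem_filter, mem_range, mem_Ico]
    omega
  rw [h2, Finset.sum_Ico_eq_sum_range]
  simp

lemma Blow_card (n m : ℕ) (hm : m ≤ n) (hm2 : 2 ≤ m) : (Blow n m).card = middleBinomSum n m := by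
  have := Blow_sum n m hm hm2 (fun _ => 1)
  simp only [sum_const, nsmul_eq_mul, mul_one] at this
  rw [middleBinomSum]
  exact_mod_cast this

lemma big_case (n m : ℕ) (hm : n < m) (F : Finset (Finset (Fin n)))
    (hcard : F.card = middleBinomSum n m) : F = Blow n m := by
  have h1 : middleBinomSum n m = 2 ^ n := by
    rw [middleBinomSum, ← Nat.sum_range_choose]
    have : (n - m + 1) / 2 = 0 := by omega
    simp only [this, zero_add]
    symm
    apply Finset.sum_subset
    · intro i; simp only [mem_range]; omega
    · intro i _ h
      rw [mem_range] at h
      exact Nat.choose_eq_zero_of_lt (by omega)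
  have h2 : F = univ := by
    rw [← Finset.card_eq_iff_eq_univ, hcard, h1]
    simp
  rw [h2]
  ext X
  have := card_le_n X
  simp only [Blow, mem_univ, mem_filter, true_and, true_iff]
  omega

/-- the weight comparison. -/
lemma weight {n m : ℕ} (hm : m ≤ n) (hm2 : 2 ≤ m) (F : Finset (Finset (Fin n)))
    (hcard : F.card = middleBinomSum n m) :
    (m : ℚ) ≤ lub ∅ univ F ∧ (lub ∅ univ F = m → ∀ X : Finset (Fin n),
      ((n - m + 1) / 2 < X.card → X.card < n - (n - m + 1) / 2 → X ∈ F) ∧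
      (X ∈ F → (n - m + 1) / 2 ≤ X.card ∧ X.card ≤ n - (n - m + 1) / 2)) := by
  set lo := (n - m + 1) / 2 with hlo
  let w : ℕ → ℚ := fun i => (n.choose i : ℚ)⁻¹ - (n.choose lo : ℚ)⁻¹
  have hlub : ∀ G : Finset (Finset (Fin n)), lub ∅ univ G =
      ∑ X ∈ G, (n.choose X.card : ℚ)⁻¹ := by
    intro G; simp [lub]
  have hB : lub ∅ univ (Blow n m) = m := by
    rw [hlub, Blow_sum n m hm hm2 (fun i => (n.choose i : ℚ)⁻¹)]
    rw [Finset.sum_congr rfl (g := fun _ => (1 : ℚ))]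
    · simp
    · intro i hi
      rw [mem_range] at hi
      apply mul_inv_cancel₀
      have : 0 < n.choose ((n - m + 1) / 2 + i) := Nat.choose_pos (by omega)
      positivity
  have hw : ∀ G : Finset (Finset (Fin n)), ∑ X : Finset (Fin n), (if X ∈ G then w X.card else 0)
      = lub ∅ univ G - G.card * (n.choose lo : ℚ)⁻¹ := by
    intro G
    rw [Finset.sum_ite_mem, univ_inter, hlub, ← nsmul_eq_mul, ← sum_const, ← sum_sub_distrib]
  have hcc : F.card = (Blow n m).card := by rw [hcard, Blow_card n m hm hm2]
  have hdiff : lub ∅ univ F - m = ∑ X : Finset (Fin n),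
      ((if X ∈ F then w X.card else 0) - (if X ∈ Blow n m then w X.card else 0)) := by
    rw [sum_sub_distrib, hw, hw, hB, hcc]; ring
  have hlopos : (0 : ℚ) < n.choose lo := by
    have : 0 < n.choose lo := Nat.choose_pos (by omega)
    exact_mod_cast this
  have hneg : ∀ i ≤ n, lo < i → i < n - lo → w i < 0 := by
    intro i hi h1 h2
    have := (lo_facts n m lo hm hm2 hlo i hi).1 h1 h2
    have h3 : (n.choose lo : ℚ) < n.choose i := by exact_mod_cast this
    have := inv_strictAnti₀ hlopos h3
    simp only [w]; linarith
  have hpos : ∀ i ≤ n, (i < lo ∨ n - lo < i) → 0 < w i := by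
    intro i hi h
    have := (lo_facts n m lo hm hm2 hlo i hi).2.1 h
    have h3 : (n.choose i : ℚ) < n.choose lo := by exact_mod_cast this
    have h4 : (0 : ℚ) < n.choose i := by exact_mod_cast Nat.choose_pos hi
    have := inv_strictAnti₀ h4 h3
    simp only [w]; linarith
  have hzero : ∀ i ≤ n, (i = lo ∨ i = n - lo) → w i = 0 := by
    intro i hi h
    have := (lo_facts n m lo hm hm2 hlo i hi).2.2 h
    simp only [w, this, sub_self]
  have hmemB : ∀ X : Finset (Fin n), X ∈ Blow n m ↔ lo ≤ X.card ∧ X.card ≤ (n + m - 1) / 2 := by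
    intro X; simp [Blow, hlo]
  have hterm : ∀ X ∈ (univ : Finset (Finset (Fin n))),
      0 ≤ ((if X ∈ F then w X.card else 0) - (if X ∈ Blow n m then w X.card else 0)) := by
    intro X _
    have hX := card_le_n X
    by_cases h1 : lo < X.card ∧ X.card < n - lo
    · have hb : X ∈ Blow n m := (hmemB X).2 (by omega)
      have := hneg X.card hX h1.1 h1.2
      rw [if_pos hb]
      split_ifs <;> linarith
    · by_cases h2 : X.card < lo ∨ n - lo < X.card
      · have hb : X ∉ Blow n m := fun h => by have := (hmemB X).1 h; omega
        have := hpos X.card hX h2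
        rw [if_neg hb]
        split_ifs <;> linarith
      · rw [hzero X.card hX (by omega)]
        simp
  refine ⟨by linarith [sum_nonneg hterm], ?_⟩
  intro heq X
  rw [heq, sub_self] at hdiff
  have hX := card_le_n X
  have hz := (sum_eq_zero_iff_of_nonneg hterm).1 hdiff.symm X (mem_univ X)
  constructor
  · intro h1 h2
    by_contra hF
    have hb : X ∈ Blow n m := (hmemB X).2 (by omega)
    rw [if_pos hb, if_neg hF] at hz
    have := hneg X.card hX h1 h2
    linarith
  · intro hF
    by_contra hcon
    have hb : X ∉ Blow n m := fun h => by have := (hmemB X).1 h; omega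
    rw [if_neg hb, if_pos hF] at hz
    have := hpos X.card hX (by omega)
    linarith


/-- For strictly decreasing path lengths `l 0 > l 1 > ⋯ > l (k-1) ≥ 3`, any
`H(l 0, …, l (k-1))`-free family of subsets of `[n]` of maximum size
`Σ(n, l 0 - 1)` must equal `B(n, l 0 - 1)`. -/
theorem harpFree_extremal (k : ℕ) (hk : 1 ≤ k) (l : Fin k → ℕ)
    (hdec : StrictAnti l) (hl : ∀ i, 3 ≤ l i)
    (n : ℕ) (hn : 1 ≤ n)
    (F : Finset (Finset (Fin n))) (hF : HarpFree n l F)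
    (hcard : F.card = middleBinomSum n (l ⟨0, by omega⟩ - 1)) :
    F = Blow n (l ⟨0, by omega⟩ - 1) ∨ F = Bhigh n (l ⟨0, by omega⟩ - 1) := by
  set m := l ⟨0, by omega⟩ - 1 with hmdef
  have hl0 := hl ⟨0, by omega⟩
  have hm2 : 2 ≤ m := by omega
  by_cases hm : n < m
  · exact Or.inl (big_case n m hm F hcard)
  replace hm : m ≤ n := by omega
  obtain ⟨hw1, hw2⟩ := weight hm hm2 F hcard
  have hns := nice_sum (nice_univ n) F (fun X _ => ⟨by simp, by simp⟩)
  have hp : (0 : ℚ) < (univ : Finset (Equiv.Perm (Fin n))).card := by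
    exact_mod_cast card_pos.2 univ_nonempty
  have hmq : (m : ℚ) = (l ⟨0, by omega⟩ : ℚ) - 1 := by
    rw [hmdef, Nat.cast_sub (by omega)]; simp
  have hall : ∀ σ : Equiv.Perm (Fin n), (onc F σ).card = m := by
    apply chains_eq hk l hdec hl F hF
    rw [sum_sub_distrib, hns, sum_const, nsmul_eq_mul, ← hmq, ← mul_sub]
    exact mul_nonpos_of_nonneg_of_nonpos hp.le (by linarith)
  have hlubm : lub ∅ univ F = m := by
    have h1 : ∑ σ : Equiv.Perm (Fin n), ((onc F σ).card : ℚ) =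
        (univ : Finset (Equiv.Perm (Fin n))).card * m := by
      rw [sum_congr rfl (fun σ _ => by rw [hall σ]), sum_const, nsmul_eq_mul]
    rw [h1] at hns
    exact (mul_left_cancel₀ hp.ne' hns).symm
  have hst := hw2 hlubm
  have hBc := Blow_card n m hm hm2
  by_cases hpar : (n - m) % 2 = 1
  · left
    apply Finset.eq_of_subset_of_card_le
    · intro X hX
      have := (hst X).2 hX
      simp only [Blow, mem_filter, mem_univ, true_and]
      omega
    · rw [hBc, hcard]
  · by_cases hex : ∃ X ∈ F, X.card = (n - m + 1) / 2
    · left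
      obtain ⟨X, hX, hXc⟩ := hex
      symm
      apply Finset.eq_of_subset_of_card_le
      · intro Y hY
        simp only [Blow, mem_filter, mem_univ, true_and] at hY
        by_cases hYc : Y.card = (n - m + 1) / 2
        · exact levels F hall X Y (by omega) hX
        · exact (hst Y).1 (by omega) (by omega)
      · rw [hBc, hcard]
    · right
      push Not at hex
      have htop : pre (1 : Equiv.Perm (Fin n)) ((n + m) / 2) ∈ F := by
        by_contra hcon
        have h1 := hall 1
        rw [onc_card] at h1
        have hsub : (range (n + 1)).filter (fun j => pre (1 : Equiv.Perm (Fin n)) j ∈ F) ⊆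
            Ioo ((n - m + 1) / 2) ((n + m) / 2) := by
          intro j hj
          obtain ⟨h2, h3⟩ := mem_filter.1 hj
          rw [mem_range] at h2
          have h4 := (hst _).2 h3
          have h5 := hex _ h3
          rw [card_pre_s16 _ _ (by omega)] at h4 h5
          have h6 : j ≠ (n + m) / 2 := by rintro rfl; exact hcon h3
          rw [mem_Ioo]
          omega
        have := card_le_card hsub
        rw [Nat.card_Ioo] at this
        omega
      have htc := card_pre_s16 (1 : Equiv.Perm (Fin n)) ((n + m) / 2) (by omega)
      ext Y
      simp only [Bhigh, mem_filter, mem_univ, true_and]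
      constructor
      · intro hY
        have h1 := (hst Y).2 hY
        have h2 := hex Y hY
        omega
      · intro hY
        by_cases hYc : Y.card = (n + m) / 2
        · exact levels F hall _ Y (by omega) htop
        · exact (hst Y).1 (by omega) (by omega)
end

section
/- For every n ≥ 5 and every diamond-free family F of subsets of [n] with ∅ ∈ F, there exists a diamond-free family G of subsets of [n−1] with ∅ ∈ G whose Lubell function satisfies h̄_{n−1}(G) ≥ h̄_n(F). (Equivalently, the maximum Lubell function value δ_n over diamond-free families of subsets of [n] containing ∅ is nonincreasing in n for n ≥ 4.) -/
open Finset

lemma le_choose_mid_s17 (n : ℕ) : ∀ k, 1 ≤ k → k < n → n ≤ n.choose k := by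
  induction n with
  | zero => intro k _ h; omega
  | succ n ih =>
    intro k h1 h2
    obtain ⟨k, rfl⟩ : ∃ j, k = j + 1 := ⟨k - 1, by omega⟩
    rw [Nat.choose_succ_succ]
    have hp : 1 ≤ n.choose k := Nat.choose_pos (by omega)
    rcases Nat.lt_or_ge (k + 1) n with h | h
    · have := ih (k + 1) (by omega) h
      simp only [Nat.succ_eq_add_one]
      omega
    · obtain rfl : n = k + 1 := by omega
      simp

lemma delta_case_top (m : ℕ) (hm : 4 ≤ m) (F : Finset (Finset (Fin (m + 1))))
    (hF : DkFree (m + 1) 2 F) (h0 : ∅ ∈ F) (h1 : univ ∈ F) :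
    ∃ G : Finset (Finset (Fin m)),
      DkFree m 2 G ∧ ∅ ∈ G ∧ lubell (m + 1) F ≤ lubell m G := by
  classical
  have hm0 : (⟨0, by omega⟩ : Fin m) ≠ ⟨1, by omega⟩ := by simp
  have e1 : (∅ : Finset (Fin m)) ≠ univ := by
    intro h
    have := congrArg Finset.card h
    simp at this
    omega
  have e1' : (∅ : Finset (Fin (m + 1))) ≠ univ := by
    intro h
    have := congrArg Finset.card h
    simp at this
  have e2 : ({⟨0, by omega⟩} : Finset (Fin m)) ≠ univ := by
    intro h
    have := congrArg Finset.card h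
    simp at this
    omega
  have e3 : ({⟨0, by omega⟩} : Finset (Fin m)) ≠ ∅ := by simp
  refine ⟨{∅, univ, {⟨0, by omega⟩}}, ?_, by simp, ?_⟩
  · rintro ⟨A, C, B, hA, hC, hB, hinj, hne, hAC, -⟩
    have h01 : B 0 ≠ B 1 := fun h => by simpa using hinj h
    have hB0 := hB 0
    have hB1 := hB 1
    have hn0 := hne 0
    have hn1 := hne 1
    simp only [mem_insert, mem_singleton] at hA hC hB0 hB1
    grind
  · have hG : lubell m {∅, univ, {⟨0, by omega⟩}} = 2 + 1 / (m : ℝ) := by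
      unfold lubell
      rw [sum_insert (by simp [e1, e3.symm]), sum_insert (by simp [e2.symm]), sum_singleton]
      simp
      ring
    rw [hG]
    have hc : ((F.erase ∅).erase univ).card ≤ 1 := by
      rw [Finset.card_le_one]
      intro X hX Y hY
      by_contra hXY
      simp only [mem_erase] at hX hY
      apply hF
      refine ⟨∅, univ, ![X, Y], h0, h1, ?_, ?_, ?_, e1', ?_⟩
      · intro i; fin_cases i
        · exact hX.2.2
        · exact hY.2.2
      · intro i j h
        fin_cases i <;> fin_cases j <;> simp_all
      · intro i; fin_cases i
        · exact ⟨hX.2.1, hX.1⟩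
        · exact ⟨hY.2.1, hY.1⟩
      · intro i; simp
    unfold lubell
    rw [← Finset.add_sum_erase F _ h0,
      ← Finset.add_sum_erase (F.erase ∅) _ (mem_erase.2 ⟨e1'.symm, h1⟩)]
    have hb : ∑ A ∈ (F.erase ∅).erase univ, (1 : ℝ) / ((m + 1).choose A.card)
        ≤ ((F.erase ∅).erase univ).card • (1 / (m : ℝ)) := by
      apply Finset.sum_le_card_nsmul
      intro A hA
      simp only [mem_erase] at hA
      have ha : 1 ≤ A.card := Finset.card_pos.2 (nonempty_iff_ne_empty.2 hA.2.1)
      have hb : A.card < m + 1 := by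
        have := (Finset.card_lt_iff_ne_univ A).2 hA.1
        simpa using this
      have := le_choose_mid_s17 (m + 1) _ ha hb
      have h2 : (m : ℝ) ≤ ((m + 1).choose A.card : ℕ) := by exact_mod_cast (by omega)
      have h3 : (0 : ℝ) < m := by exact_mod_cast (by omega)
      exact one_div_le_one_div_of_le h3 h2
    have hb2 : ((F.erase ∅).erase univ).card • (1 / (m : ℝ)) ≤ 1 / (m : ℝ) := by
      rw [nsmul_eq_mul]
      have : (((F.erase ∅).erase univ).card : ℝ) ≤ 1 := by exact_mod_cast hc
      have h3 : (0 : ℝ) ≤ 1 / m := by positivity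
      nlinarith
    have : (1 : ℝ) / ((m + 1).choose (∅ : Finset (Fin (m+1))).card) = 1 := by simp
    have : (1 : ℝ) / ((m + 1).choose (univ : Finset (Fin (m+1))).card) = 1 := by simp
    linarith

lemma delta_case_avg (m : ℕ) (F : Finset (Finset (Fin (m + 1))))
    (hF : DkFree (m + 1) 2 F) (h0 : ∅ ∈ F) (h1 : univ ∉ F) :
    ∃ G : Finset (Finset (Fin m)),
      DkFree m 2 G ∧ ∅ ∈ G ∧ lubell (m + 1) F ≤ lubell m G := by
  classical
  let G : Fin (m + 1) → Finset (Finset (Fin m)) := fun i =>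
    univ.filter (fun A => A.map i.succAboveEmb ∈ F)
  have hlub : ∀ i, lubell m (G i) = ∑ A ∈ F, if i ∈ A then 0 else (1 : ℝ) / (m.choose A.card) := by
    intro i
    have : ∀ A : Finset (Fin (m + 1)), (if i ∈ A then 0 else (1 : ℝ) / (m.choose A.card))
        = if i ∉ A then (1 : ℝ) / (m.choose A.card) else 0 := by
      intro A; split_ifs <;> simp_all
    simp only [this]
    rw [← Finset.sum_filter]
    unfold lubell
    refine Finset.sum_bij (fun A _ => A.map i.succAboveEmb) ?_ ?_ ?_ ?_
    · intro A hA
      simp only [G, mem_filter, mem_univ, true_and] at hA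
      simp [hA, Fin.succAbove_ne]
    · intro A _ B _ h
      exact Finset.map_injective _ h
    · intro B hB
      simp only [mem_filter] at hB
      have hm : (univ.filter (fun x => i.succAbove x ∈ B)).map i.succAboveEmb = B := by
        ext x
        simp only [mem_map, mem_filter, mem_univ, true_and, Fin.succAboveEmb_apply]
        constructor
        · rintro ⟨y, hy, rfl⟩; exact hy
        · intro hx
          obtain ⟨y, rfl⟩ := Fin.exists_succAbove_eq (x := x) (y := i) (by rintro rfl; exact hB.2 hx)
          exact ⟨y, hx, rfl⟩
      refine ⟨univ.filter (fun x => i.succAbove x ∈ B), ?_, hm⟩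
      simp only [G, mem_filter, mem_univ, true_and]
      rw [hm]; exact hB.1
    · intro A _
      simp
  have hsum : ∑ _i : Fin (m + 1), lubell (m + 1) F ≤ ∑ i : Fin (m + 1), lubell m (G i) := by
    apply le_of_eq
    simp only [hlub]
    rw [Finset.sum_comm]
    simp only [sum_const, card_univ, Fintype.card_fin, nsmul_eq_mul]
    unfold lubell
    rw [Finset.mul_sum]
    apply Finset.sum_congr rfl
    intro A hA
    have hb : A.card ≤ m := by
      have := (Finset.card_lt_iff_ne_univ A).2 (fun h => h1 (h ▸ hA))
      simp at this
      omega
    have : ∀ i : Fin (m + 1), (if i ∈ A then 0 else (1 : ℝ) / (m.choose A.card))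
        = if i ∈ Aᶜ then (1 : ℝ) / (m.choose A.card) else 0 := by
      intro i; by_cases h : i ∈ A <;> simp [h]
    simp only [this]
    rw [Finset.sum_ite_mem, Finset.univ_inter, sum_const, card_compl, Fintype.card_fin,
      nsmul_eq_mul]
    have hk := Nat.choose_mul_succ_eq m A.card
    have hk' : (m.choose A.card : ℝ) * ((m + 1 : ℕ) : ℝ)
        = ((m + 1).choose A.card : ℝ) * ((m + 1 - A.card : ℕ) : ℝ) := by exact_mod_cast hk
    have p1 : (0 : ℝ) < m.choose A.card := by exact_mod_cast Nat.choose_pos hb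
    have p2 : (0 : ℝ) < (m + 1).choose A.card := by
      exact_mod_cast Nat.choose_pos (by omega)
    rw [mul_one_div, mul_one_div, div_eq_div_iff p2.ne' p1.ne']
    linarith
  obtain ⟨i, -, hi⟩ := Finset.exists_le_of_sum_le univ_nonempty hsum
  refine ⟨G i, ?_, by simpa [G] using h0, hi⟩
  rintro ⟨A, C, B, hA, hC, hB, hinj, hne, hAC, hsub⟩
  simp only [G, mem_filter, mem_univ, true_and] at hA hC hB
  have mi := Finset.map_injective i.succAboveEmb
  exact hF ⟨_, _, fun j => (B j).map i.succAboveEmb, hA, hC, hB, mi.comp hinj,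
    fun j => ⟨mi.ne (hne j).1, mi.ne (hne j).2⟩, mi.ne hAC,
    fun j => ⟨map_subset_map.2 (hsub j).1, map_subset_map.2 (hsub j).2⟩⟩

/-- For `n ≥ 5`, for every diamond-free family `F` of subsets of `[n]`
containing `∅`, there is a diamond-free family `G` of subsets of `[n-1]`
containing `∅` with `h̄_{n-1}(G) ≥ h̄_n(F)`; i.e., the maximum Lubell value
`δ_n` over such families is nonincreasing for `n ≥ 4`. -/
theorem delta_nonincreasing (n : ℕ) (hn : 5 ≤ n)
    (F : Finset (Finset (Fin n))) (hF : DkFree n 2 F) (h0 : ∅ ∈ F) :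
    ∃ G : Finset (Finset (Fin (n - 1))),
      DkFree (n - 1) 2 G ∧ ∅ ∈ G ∧ lubell n F ≤ lubell (n - 1) G := by
  obtain ⟨m, rfl⟩ : ∃ m, n = m + 1 := ⟨n - 1, by omega⟩
  by_cases h1 : univ ∈ F
  · exact delta_case_top m (by omega) F hF h0 h1
  · exact delta_case_avg m F hF h0 h1
end
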